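/- arXiv:2203.02457 — 4 statements merged into one kernel-verified Lean document; each statement's English description precedes it below -/
import Mathlib

section
/- Let c ≥ 2 be an integer and C = {1, 2c}. Then for every n ≥ 1, G_C(n + 12c) = G_C(n) + 8, and for 1 ≤ n ≤ 12c the values of G_C(n) are: 0 if 1 ≤ n ≤ 2c and n is odd; 1 if 1 ≤ n ≤ 2c and n is even; 2 if 2c < n ≤ 4c and n is odd; 3 if 2c < n ≤ 4c and n is even; 1 if n = 4c+1; 4 if n = 4c+2; 5 if 4c+2 < n ≤ 6c and n is odd; 4 if 4c+2 < n ≤ 6c and n is even; 3 if 6c < n ≤ 8c and n is odd; 2 if 6c < n ≤ 8c and n is even; 4 if 8c < n ≤ 10c and n is odd; 5 if 8c < n ≤ 10c and n is even; 6 if 10c < n ≤ 12c and n is odd; 7 if 10c < n ≤ 12c and n is even. (In particular the nim-sequence is arithmetic-periodic with period 12c and saltus 8.) -/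
/-- The minimum excludant of a set of naturals. -/
noncomputable def mex (S : Set ℕ) : ℕ := sInf {v | v ∉ S}

/-- Fueled auxiliary for the Grundy sequence of CUT with cut-set `C`. -/
noncomputable def cutGAux (C : Finset ℕ) : ℕ → ℕ → ℕ
  | 0, _ => 0
  | fuel + 1, n =>
      mex {v | ∃ d ∈ C, ∃ l : List ℕ, l.length = d + 1 ∧ (∀ x ∈ l, 0 < x) ∧
            l.sum = n ∧ (l.map (cutGAux C fuel)).foldr (· ^^^ ·) 0 = v}

/-- The Grundy (nim-value) sequence of the game CUT with cut-set `C`. -/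
noncomputable def cutG (C : Finset ℕ) (n : ℕ) : ℕ := cutGAux C n n

/-- The nim-value of an option (a tuple of pile sizes). -/
noncomputable def nimVal (C : Finset ℕ) (l : List ℕ) : ℕ :=
  (l.map (cutG C)).foldr (· ^^^ ·) 0

namespace CutPeriodic

theorem xor_le_add (a b : ℕ) : a ^^^ b ≤ a + b := by
  induction a using Nat.strong_induction_on generalizing b with
  | _ a ih =>
    rcases Nat.eq_zero_or_pos a with rfl | ha
    · simp
    · have h := ih (a / 2) (by omega) (b / 2)
      rw [← Nat.xor_div_two] at h
      have h2 := Nat.xor_mod_two_eq (m := a) (n := b)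
      omega

/-- The value of the claimed Grundy sequence at `e + 1` over one period, with parity removed. -/
def baseVal (c e : ℕ) : ℕ :=
  if e < 2 * c then 0
  else if e < 4 * c then 2
  else if e = 4 * c then 1
  else if e < 6 * c then 5
  else if e < 8 * c then 3
  else if e < 10 * c then 4
  else 6

/-- The value of the claimed Grundy sequence at `e + 1`, with parity removed. -/
def flatVal (c e : ℕ) : ℕ := 8 * (e / (12 * c)) + baseVal c (e % (12 * c))

/-- The claimed Grundy sequence. -/
def claimedVal (c n : ℕ) : ℕ := flatVal c (n - 1) ^^^ ((n - 1) % 2)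

/-- A lower bound for the total excess of any tuple of piles whose flat values have nim-sum `r`. -/
def baseWeight (c : ℕ) : ℕ → ℕ
  | 0 => 0
  | 1 => 4 * c
  | 2 => 2 * c
  | 3 => 6 * c
  | 4 => 8 * c
  | 5 => 4 * c + 1
  | 6 => 10 * c
  | _ => 6 * c

/-- The extension of `baseWeight` to all nim-values. -/
def weight (c x : ℕ) : ℕ := 12 * c * (x / 8) + baseWeight c (x % 8)

theorem baseVal_lt (c e : ℕ) : baseVal c e < 8 := by
  unfold baseVal; split_ifs <;> norm_num

theorem xor_div_eight (x y : ℕ) : (x ^^^ y) / 8 = x / 8 ^^^ y / 8 :=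
  Nat.xor_div_two_pow (n := 3)

theorem xor_mod_eight (x y : ℕ) : (x ^^^ y) % 8 = x % 8 ^^^ y % 8 :=
  Nat.xor_mod_two_pow (n := 3)

theorem mul_eight_add_xor (a b r s : ℕ) (hr : r < 8) (hs : s < 8) :
    (8 * a + r) ^^^ (8 * b + s) = 8 * (a ^^^ b) + (r ^^^ s) := by
  have h1 := xor_div_eight (8 * a + r) (8 * b + s)
  have h2 := xor_mod_eight (8 * a + r) (8 * b + s)
  rw [show (8 * a + r) / 8 = a by omega, show (8 * b + s) / 8 = b by omega] at h1
  rw [show (8 * a + r) % 8 = r by omega, show (8 * b + s) % 8 = s by omega] at h2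
  omega

theorem baseVal_cases (c e : ℕ) :
    e < 2 * c ∧ baseVal c e = 0 ∨ 2 * c ≤ e ∧ e < 4 * c ∧ baseVal c e = 2 ∨
    e = 4 * c ∧ baseVal c e = 1 ∨ 4 * c < e ∧ e < 6 * c ∧ baseVal c e = 5 ∨
    6 * c ≤ e ∧ e < 8 * c ∧ baseVal c e = 3 ∨ 8 * c ≤ e ∧ e < 10 * c ∧ baseVal c e = 4 ∨
    10 * c ≤ e ∧ baseVal c e = 6 := by
  unfold baseVal; split_ifs <;> omega

theorem flatVal_mul_add (c k e : ℕ) (he : e < 12 * c) :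
    flatVal c (12 * c * k + e) = 8 * k + baseVal c e := by
  have hc : 0 < 12 * c := by omega
  rw [flatVal, Nat.mul_add_div hc, Nat.mul_add_mod, Nat.div_eq_of_lt he, Nat.mod_eq_of_lt he,
    add_zero]

theorem flatVal_of_lt (c e : ℕ) (he : e < 12 * c) : flatVal c e = baseVal c e := by
  simpa using flatVal_mul_add c 0 e he

theorem flatVal_of_small (c e : ℕ) (he : e < 2 * c) : flatVal c e = 0 := by
  rw [flatVal_of_lt c e (by omega), baseVal, if_pos he]

theorem baseWeight_xor_le (c r s : ℕ) (hc : 0 < c) (hr : r < 8) (hs : s < 8) :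
    baseWeight c (r ^^^ s) ≤ baseWeight c r + baseWeight c s := by
  interval_cases r <;> interval_cases s <;>
  simp only [baseWeight, Nat.reduceXor] <;> omega

theorem weight_xor_le (c x y : ℕ) (hc : 0 < c) : weight c (x ^^^ y) ≤ weight c x + weight c y := by
  have h1 := Nat.mul_le_mul_left (12 * c) (xor_le_add (x / 8) (y / 8))
  have h2 := baseWeight_xor_le c (x % 8) (y % 8) hc (by omega) (by omega)
  rw [← xor_div_eight, mul_add] at h1
  rw [← xor_mod_eight] at h2
  simp only [weight]
  omega

theorem weight_flatVal (c m : ℕ) :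
    weight c (flatVal c m) = 12 * c * (m / (12 * c)) + baseWeight c (baseVal c (m % (12 * c))) := by
  have := baseVal_lt c (m % (12 * c))
  rw [weight, flatVal, Nat.mul_add_div (by norm_num), Nat.mul_add_mod, Nat.div_eq_of_lt this,
    Nat.mod_eq_of_lt this, add_zero]

theorem weight_flatVal_le (c m : ℕ) : weight c (flatVal c m) ≤ m := by
  rw [weight_flatVal]
  have h := Nat.div_add_mod m (12 * c)
  have : baseWeight c (baseVal c (m % (12 * c))) ≤ m % (12 * c) := by
    unfold baseVal; split_ifs <;> simp only [baseWeight] <;> omega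
  omega

theorem lt_weight_flatVal (c m : ℕ) (hc : 0 < c) : m < weight c (flatVal c m) + 2 * c := by
  rw [weight_flatVal]
  have h := Nat.div_add_mod m (12 * c)
  have h2 := Nat.mod_lt m (show 0 < 12 * c by omega)
  have : m % (12 * c) < baseWeight c (baseVal c (m % (12 * c))) + 2 * c := by
    unfold baseVal; split_ifs <;> simp only [baseWeight] <;> omega
  omega

theorem mod_two_xor (a b : ℕ) : a % 2 ^^^ b % 2 = (a + b) % 2 := by
  rcases Nat.mod_two_eq_zero_or_one a with h | h <;>
  rcases Nat.mod_two_eq_zero_or_one b with h' | h' <;>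
  simp [Nat.add_mod, h, h']

/-- The nim-sum of the claimed values over a tuple of piles. -/
abbrev claimedSum (c : ℕ) (l : List ℕ) : ℕ := (l.map (claimedVal c)).foldr (· ^^^ ·) 0

theorem weight_claimedSum_le (c : ℕ) (hc : 0 < c) (l : List ℕ) (hl : ∀ x ∈ l, 0 < x) :
    weight c (claimedSum c l ^^^ ((l.sum + l.length) % 2)) + l.length ≤ l.sum := by
  induction l with
  | nil => simp [claimedSum, weight, baseWeight]
  | cons a l ih =>
    have ha : 0 < a := hl a (by simp)
    have ih := ih fun x hx => hl x (by simp [hx])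
    have key : claimedSum c (a :: l) ^^^ (((a :: l).sum + (a :: l).length) % 2) =
        flatVal c (a - 1) ^^^ (claimedSum c l ^^^ ((l.sum + l.length) % 2)) := by
      have : ((a :: l).sum + (a :: l).length) % 2 =
          (a - 1) % 2 ^^^ ((l.sum + l.length) % 2) := by
        rw [mod_two_xor]; simp only [List.sum_cons, List.length_cons]; omega
      rw [this]
      simp only [claimedSum, claimedVal, List.map_cons, List.foldr_cons]
      generalize (a - 1) % 2 = p
      generalize (l.sum + l.length) % 2 = q
      generalize flatVal c (a - 1) = f
      generalize List.foldr _ _ _ = g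
      rw [show f ^^^ p ^^^ g ^^^ (p ^^^ q) = (p ^^^ p) ^^^ (f ^^^ (g ^^^ q)) by ac_rfl]
      simp
    rw [key]
    have h1 := weight_xor_le c (flatVal c (a - 1)) (claimedSum c l ^^^ ((l.sum + l.length) % 2)) hc
    have h2 := weight_flatVal_le c (a - 1)
    simp only [List.sum_cons, List.length_cons]
    omega

theorem claimedSum_ne_of_length (c : ℕ) (hc : 0 < c) (l : List ℕ) (hl : ∀ x ∈ l, 0 < x)
    (hlen : l.length = 2 * c + 1) : claimedSum c l ≠ claimedVal c l.sum := by
  intro h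
  have h1 := weight_claimedSum_le c hc l hl
  have h2 := lt_weight_flatVal c (l.sum - 1) hc
  have hs : 0 < l.sum := by omega
  rw [h, claimedVal, show (l.sum + l.length) % 2 = (l.sum - 1) % 2 by omega,
    Nat.xor_assoc, Nat.xor_self, Nat.xor_zero] at h1
  omega

theorem baseVal_xor_ne (c a b : ℕ) (hab : a + b + 1 < 12 * c) :
    baseVal c a ^^^ baseVal c b ^^^ 1 ≠ baseVal c (a + b + 1) := by
  have hn := baseVal_cases c (a + b + 1)
  rcases baseVal_cases c a with ⟨h, e⟩ | ⟨h, h', e⟩ | ⟨h, e⟩ | ⟨h, h', e⟩ | ⟨h, h', e⟩ |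
    ⟨h, h', e⟩ | ⟨h, e⟩ <;>
  rcases baseVal_cases c b with ⟨k, f⟩ | ⟨k, k', f⟩ | ⟨k, f⟩ | ⟨k, k', f⟩ | ⟨k, k', f⟩ |
    ⟨k, k', f⟩ | ⟨k, f⟩ <;>
  simp only [e, f, Nat.reduceXor] <;> omega

theorem flatVal_xor_ne (c a b : ℕ) (hc : 0 < c) :
    flatVal c a ^^^ flatVal c b ^^^ 1 ≠ flatVal c (a + b + 1) := by
  intro h
  have hp : 0 < 12 * c := by omega
  have ha := Nat.div_add_mod a (12 * c)
  have hb := Nat.div_add_mod b (12 * c)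
  have hn := Nat.div_add_mod (a + b + 1) (12 * c)
  have la := baseVal_lt c (a % (12 * c))
  have lb := baseVal_lt c (b % (12 * c))
  have ln := baseVal_lt c ((a + b + 1) % (12 * c))
  have ma := Nat.mod_lt a hp
  have mb := Nat.mod_lt b hp
  have mn := Nat.mod_lt (a + b + 1) hp
  have e1 : ∀ r < 8, r ^^^ 1 < 8 := by decide
  have e2 : ∀ r < 8, ∀ s < 8, r ^^^ s < 8 := by decide
  rw [flatVal, flatVal, flatVal, mul_eight_add_xor _ _ _ _ la lb] at h
  have h3 := mul_eight_add_xor (a / (12 * c) ^^^ b / (12 * c)) 0 _ 1 (e2 _ la _ lb) (by norm_num)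
  rw [mul_zero, zero_add, Nat.xor_zero] at h3
  rw [h3] at h
  have l3 := e1 _ (e2 _ la _ lb)
  have hq : a / (12 * c) ^^^ b / (12 * c) = (a + b + 1) / (12 * c) := by omega
  have hr : baseVal c (a % (12 * c)) ^^^ baseVal c (b % (12 * c)) ^^^ 1 =
    baseVal c ((a + b + 1) % (12 * c)) := by omega
  have hle := Nat.mul_le_mul_left (12 * c) (xor_le_add (a / (12 * c)) (b / (12 * c)))
  rw [hq, mul_add] at hle
  have hlow : (a + b + 1) / (12 * c) ≥ a / (12 * c) + b / (12 * c) := by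
    rw [ge_iff_le, Nat.le_div_iff_mul_le hp, mul_comm, mul_add]; omega
  have hlow := Nat.mul_le_mul_left (12 * c) hlow
  rw [mul_add] at hlow
  have hs : (a + b + 1) % (12 * c) = a % (12 * c) + b % (12 * c) + 1 := by omega
  rw [hs] at hr mn
  exact baseVal_xor_ne c _ _ mn hr

theorem claimedVal_xor_ne (c a b : ℕ) (hc : 0 < c) (ha : 0 < a) (hb : 0 < b) :
    claimedVal c a ^^^ claimedVal c b ≠ claimedVal c (a + b) := by
  intro h
  apply flatVal_xor_ne c (a - 1) (b - 1) hc
  rw [show a - 1 + (b - 1) + 1 = a + b - 1 by omega]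
  have hp : (a + b - 1) % 2 = (a - 1) % 2 ^^^ (b - 1) % 2 ^^^ 1 := by
    have : (a - 1 + (b - 1)) % 2 ^^^ 1 = _ := mod_two_xor (a - 1 + (b - 1)) 1
    rw [mod_two_xor, this]
    congr 1
    omega
  simp only [claimedVal, hp] at h
  generalize (a - 1) % 2 = p at *
  generalize (b - 1) % 2 = q at *
  generalize flatVal c (a - 1) = f at *
  generalize flatVal c (b - 1) = g at *
  generalize flatVal c (a + b - 1) = k at *
  have h := congrArg (· ^^^ (p ^^^ q ^^^ 1)) h
  rw [show f ^^^ p ^^^ (g ^^^ q) ^^^ (p ^^^ q ^^^ 1) =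
      ((p ^^^ p) ^^^ (q ^^^ q)) ^^^ (f ^^^ g ^^^ 1) by ac_rfl,
    Nat.xor_assoc k, Nat.xor_self, Nat.xor_self, Nat.xor_self] at h
  simpa using h

theorem flatVal_xor_mul_add (c k a b : ℕ) (ha : a < 12 * c) (hb : b < 12 * c) :
    flatVal c a ^^^ flatVal c (12 * c * k + b) = 8 * k + (baseVal c a ^^^ baseVal c b) := by
  rw [flatVal_of_lt c a ha, flatVal_mul_add c k b hb]
  have := mul_eight_add_xor 0 k _ _ (baseVal_lt c a) (baseVal_lt c b)
  simpa using this

/-- `u` is the nim-sum of the flat values of two piles of total excess at most `m - 2 * c`. -/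
def LongReach (c m u : ℕ) : Prop :=
  ∃ a b, a + b + 2 * c ≤ m ∧ flatVal c a ^^^ flatVal c b = u

/-- `u` differs in the last bit from the nim-sum of the flat values of two piles of total
excess `m - 1`. -/
def PairReach (c m u : ℕ) : Prop :=
  ∃ a b, a + b + 1 = m ∧ flatVal c a ^^^ flatVal c b ^^^ 1 = u

theorem longReach_of (c k x a b r : ℕ) (ha : a < 12 * c) (hb : b < 12 * c)
    (hx : a + b + 2 * c ≤ x) (hr : baseVal c a ^^^ baseVal c b = r) :
    LongReach c (12 * c * k + x) (8 * k + r) :=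
  ⟨a, 12 * c * k + b, by omega, by rw [flatVal_xor_mul_add c k a b ha hb, hr]⟩

theorem pairReach_of (c k x a b r : ℕ) (ha : a < 12 * c) (hb : b < 12 * c)
    (hx : a + b + 1 = x) (hr : baseVal c a ^^^ baseVal c b ^^^ 1 = r) :
    PairReach c (12 * c * k + x) (8 * k + r) := by
  refine ⟨a, 12 * c * k + b, by omega, ?_⟩
  have e2 : ∀ r < 8, ∀ s < 8, r ^^^ s < 8 := by decide
  have := mul_eight_add_xor k 0 _ 1 (e2 _ (baseVal_lt c a) _ (baseVal_lt c b)) (by norm_num)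
  rw [flatVal_xor_mul_add c k a b ha hb, ← hr]
  simpa using this

theorem reach (c k x j : ℕ) (hc : 2 ≤ c) (hj : j < 8)
    (hx : 12 * c ≤ x ∨ (x < 12 * c ∧ (x % 2 = 0 ∧ j < baseVal c x ∨
      x % 2 = 1 ∧ j ^^^ 1 < baseVal c x ^^^ 1))) :
    LongReach c (12 * c * k + x) (8 * k + j) ∨ PairReach c (12 * c * k + x) (8 * k + j) := by
  have v0 : ∀ e, e < 2 * c → baseVal c e = 0 := fun e h => by
    unfold baseVal; exact if_pos h
  have v2 : ∀ e, 2 * c ≤ e → e < 4 * c → baseVal c e = 2 := fun e h h' => by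
    unfold baseVal; split_ifs <;> omega
  have v1 : baseVal c (4 * c) = 1 := by
    unfold baseVal; split_ifs <;> omega
  have v5 : ∀ e, 4 * c < e → e < 6 * c → baseVal c e = 5 := fun e h h' => by
    unfold baseVal; split_ifs <;> omega
  have v3 : baseVal c (6 * c) = 3 := by
    unfold baseVal; split_ifs <;> omega
  have v4 : baseVal c (8 * c) = 4 := by
    unfold baseVal; split_ifs <;> omega
  have hreg := baseVal_cases c x
  generalize baseVal c x = g at hx hreg
  have hx' : 12 * c ≤ x ∨ x < 12 * c ∧ (x % 2 = 0 ∧ j < g ∨ x % 2 = 1 ∧ (j < g ∧ g % 2 = 0 ∨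
      j + 1 < g ∨ j = g + 1 ∧ g % 2 = 0)) := by
    refine hx.imp_right fun h => ⟨h.1, h.2.imp_right fun h => ⟨h.1, ?_⟩⟩
    have h2 := h.2
    have h3 := Nat.xor_div_two (a := j) (b := 1)
    have h4 := Nat.xor_mod_two_eq (m := j) (n := 1)
    have h5 := Nat.xor_div_two (a := g) (b := 1)
    have h6 := Nat.xor_mod_two_eq (m := g) (n := 1)
    norm_num at h3 h5
    omega
  clear hx
  interval_cases j
  · exact .inl (longReach_of c k x 0 0 _ (by omega) (by omega) (by omega) (by simp))
  · by_cases h1 : 6 * c ≤ x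
    · exact .inl (longReach_of c k x (4 * c) 0 _ (by omega) (by omega) (by omega)
        (by simp [v1, v0 0 (by omega)]))
    · by_cases h2 : x < 4 * c
      · exact .inr (pairReach_of c k x ((x - 1) / 2) (x - 1 - (x - 1) / 2) _ (by omega) (by omega)
          (by omega) (by rw [v0 _ (by omega), v0 _ (by omega)]; rfl))
      · exact .inr (pairReach_of c k x (2 * c) (x - 1 - 2 * c) _ (by omega) (by omega)
          (by omega) (by rw [v2 _ (by omega) (by omega), v2 _ (by omega) (by omega)]; rfl))
  · exact .inl (longReach_of c k x (2 * c) 0 _ (by omega) (by omega) (by omega)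
      (by rw [v2 _ (by omega) (by omega), v0 _ (by omega)]; rfl))
  · by_cases h1 : 8 * c ≤ x
    · exact .inl (longReach_of c k x (6 * c) 0 _ (by omega) (by omega) (by omega)
        (by rw [v3, v0 _ (by omega)]; rfl))
    · by_cases h2 : x ≤ 4 * c
      · exact .inr (pairReach_of c k x 0 (x - 1) _ (by omega) (by omega) (by omega)
          (by rw [v0 _ (by omega), v2 _ (by omega) (by omega)]; rfl))
      · exact .inr (pairReach_of c k x (2 * c - 1) (x - 2 * c) _ (by omega) (by omega)
          (by omega) (by rw [v0 _ (by omega), v2 _ (by omega) (by omega)]; rfl))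
  · by_cases h1 : 10 * c ≤ x
    · exact .inl (longReach_of c k x (8 * c) 0 _ (by omega) (by omega) (by omega)
        (by rw [v4, v0 _ (by omega)]; rfl))
    · exact .inr (pairReach_of c k x 0 (x - 1) _ (by omega) (by omega) (by omega)
        (by rw [v0 _ (by omega), v5 _ (by omega) (by omega)]; rfl))
  · exact .inl (longReach_of c k x (4 * c + 1) 0 _ (by omega) (by omega) (by omega)
      (by rw [v5 _ (by omega) (by omega), v0 _ (by omega)]; rfl))
  · exact .inl (longReach_of c k x (8 * c) (2 * c) _ (by omega) (by omega) (by omega)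
      (by rw [v4, v2 _ (by omega) (by omega)]; rfl))
  · exact .inl (longReach_of c k x (4 * c + 1) (2 * c) _ (by omega) (by omega) (by omega)
      (by rw [v5 _ (by omega) (by omega), v2 _ (by omega) (by omega)]; rfl))

/-- The nim-values of the options of a pile of size `n` in CUT for `{1, 2 * c}`, computed
with the piles evaluated by `f`. -/
def optionValues (c : ℕ) (f : ℕ → ℕ) (n : ℕ) : Set ℕ :=
  {v | ∃ d ∈ ({1, 2 * c} : Finset ℕ), ∃ l : List ℕ, l.length = d + 1 ∧ (∀ x ∈ l, 0 < x) ∧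
    l.sum = n ∧ (l.map f).foldr (· ^^^ ·) 0 = v}

theorem claimedVal_notMem (c n : ℕ) (hc : 0 < c) :
    claimedVal c n ∉ optionValues c (claimedVal c) n := by
  rintro ⟨d, hd, l, hlen, hpos, rfl, hv⟩
  simp only [Finset.mem_insert, Finset.mem_singleton] at hd
  rcases hd with rfl | rfl
  · obtain ⟨a, b, rfl⟩ := List.length_eq_two.mp hlen
    refine claimedVal_xor_ne c a b hc (hpos a (by simp)) (hpos b (by simp)) ?_
    simpa using hv
  · exact claimedSum_ne_of_length c hc l hpos hlen hv

theorem foldr_xor_replicate_zero (k : ℕ) : (List.replicate k 0).foldr (· ^^^ ·) 0 = 0 := by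
  induction k with
  | zero => rfl
  | succ k ih => simp [List.replicate_succ, ih]

theorem LongReach.mem_optionValues {c m u : ℕ} (hc : 2 ≤ c) (h : LongReach c m u) :
    u ^^^ m % 2 ∈ optionValues c (claimedVal c) (m + 1) := by
  obtain ⟨a, b, hab, rfl⟩ := h
  refine ⟨2 * c, by simp, [a + 1, b + 1, (m - 2 * c - a - b) / 2 + 1,
    (m - 2 * c - a - b) / 2 + 1, (m - 2 * c - a - b) % 2 + 1] ++ List.replicate (2 * c - 4) 1,
    ?_, ?_, ?_, ?_⟩
  · simp; omega
  · intro x hx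
    simp only [List.mem_append, List.mem_cons, List.not_mem_nil, or_false,
      List.mem_replicate] at hx
    omega
  · simp; omega
  · have h0 : claimedVal c 1 = 0 := by
      simp [claimedVal, flatVal_of_small c 0 (by omega)]
    have ht : claimedVal c ((m - 2 * c - a - b) % 2 + 1) = (m - 2 * c - a - b) % 2 := by
      rw [claimedVal, Nat.add_sub_cancel, flatVal_of_small c _ (by omega)]
      simp
    have hm : m % 2 = a % 2 ^^^ b % 2 ^^^ (m - 2 * c - a - b) % 2 := by
      rw [mod_two_xor, mod_two_xor]; omega
    rw [List.map_append, List.foldr_append, List.map_replicate, h0, foldr_xor_replicate_zero, hm]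
    simp only [List.map_cons, List.map_nil, List.foldr_cons, List.foldr_nil, ht]
    generalize claimedVal c ((m - 2 * c - a - b) / 2 + 1) = s
    generalize (m - 2 * c - a - b) % 2 = t
    simp only [claimedVal, Nat.add_sub_cancel, Nat.xor_zero]
    rw [← Nat.xor_assoc s, Nat.xor_self, Nat.zero_xor]
    ac_rfl

theorem PairReach.mem_optionValues {c m u : ℕ} (h : PairReach c m u) :
    u ^^^ m % 2 ∈ optionValues c (claimedVal c) (m + 1) := by
  obtain ⟨a, b, rfl, rfl⟩ := h
  refine ⟨1, by simp, [a + 1, b + 1], rfl, by simp, by simp; omega, ?_⟩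
  have h1 : (a + b) % 2 ^^^ 1 = (a + b + 1) % 2 := mod_two_xor (a + b) 1
  rw [← h1, ← mod_two_xor]
  simp only [claimedVal, List.map_cons, List.map_nil, List.foldr_cons, List.foldr_nil,
    Nat.add_sub_cancel, Nat.xor_zero]
  rw [show flatVal c a ^^^ flatVal c b ^^^ 1 ^^^ (a % 2 ^^^ b % 2 ^^^ 1) =
    (1 ^^^ 1) ^^^ (flatVal c a ^^^ a % 2 ^^^ (flatVal c b ^^^ b % 2)) by ac_rfl, Nat.xor_self,
    Nat.zero_xor]

theorem mem_optionValues_of_lt (c n v : ℕ) (hc : 2 ≤ c) (hn : 0 < n) (hv : v < claimedVal c n) :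
    v ∈ optionValues c (claimedVal c) n := by
  obtain ⟨m, rfl⟩ : ∃ m, n = m + 1 := ⟨n - 1, by omega⟩
  rw [claimedVal, Nat.add_sub_cancel] at hv
  have huv : v ^^^ m % 2 ^^^ m % 2 = v := by rw [Nat.xor_assoc, Nat.xor_self, Nat.xor_zero]
  set u := v ^^^ m % 2
  have hreach : LongReach c m u ∨ PairReach c m u := by
    have hp : 0 < 12 * c := by omega
    have hlt := baseVal_lt c (m % (12 * c))
    have hm := Nat.div_add_mod m (12 * c)
    have hml := Nat.mod_lt m hp
    have hpar : m % (12 * c) % 2 = m % 2 := by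
      rw [Nat.mod_mod_of_dvd]; exact ⟨6 * c, by ring⟩
    have e1 : ∀ r < 8, r ^^^ 1 < 8 := by decide
    have hk : u / 8 ≤ m / (12 * c) := by
      rw [← huv, flatVal] at hv
      rcases Nat.mod_two_eq_zero_or_one m with h | h <;> rw [h] at hv
      · rw [Nat.xor_zero, Nat.xor_zero] at hv; omega
      · have h1 := mul_eight_add_xor (u / 8) 0 (u % 8) 1 (by omega) (by norm_num)
        have h2 := mul_eight_add_xor (m / (12 * c)) 0 _ 1 hlt (by norm_num)
        have l1 := e1 (u % 8) (by omega)
        have l2 := e1 _ hlt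
        rw [mul_zero, zero_add, Nat.xor_zero] at h1 h2
        rw [Nat.div_add_mod] at h1
        omega
    have hle := Nat.mul_le_mul_left (12 * c) hk
    have key := reach c (u / 8) (m - 12 * c * (u / 8)) (u % 8) hc (by omega) ?_
    · rwa [Nat.div_add_mod, Nat.add_sub_cancel' (by omega)] at key
    · rcases hk.lt_or_eq with hk | hk
      · left
        have := Nat.mul_le_mul_left (12 * c) (Nat.succ_le_of_lt hk)
        rw [Nat.mul_succ] at this
        omega
      · right
        rw [hk, show m - 12 * c * (m / (12 * c)) = m % (12 * c) by omega]
        refine ⟨hml, ?_⟩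
        rw [hpar]
        rw [← huv, flatVal] at hv
        rcases Nat.mod_two_eq_zero_or_one m with h | h <;> rw [h] at hv
        · rw [Nat.xor_zero, Nat.xor_zero] at hv; omega
        · have h1 := mul_eight_add_xor (u / 8) 0 (u % 8) 1 (by omega) (by norm_num)
          have h2 := mul_eight_add_xor (m / (12 * c)) 0 _ 1 hlt (by norm_num)
          rw [mul_zero, zero_add, Nat.xor_zero] at h1 h2
          rw [Nat.div_add_mod] at h1
          omega
  rw [← huv]
  exact hreach.elim (LongReach.mem_optionValues hc) PairReach.mem_optionValues

theorem mex_optionValues (c n : ℕ) (hc : 2 ≤ c) (hn : 0 < n) :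
    mex (optionValues c (claimedVal c) n) = claimedVal c n := by
  have hmem := claimedVal_notMem c n (by omega)
  refine le_antisymm (Nat.sInf_le hmem) (le_csInf ⟨_, hmem⟩ fun v hv => ?_)
  by_contra! h
  exact hv (mem_optionValues_of_lt c n v hc hn h)

theorem optionValues_congr (c n : ℕ) (hc : 0 < c) (f g : ℕ → ℕ)
    (hfg : ∀ x, 0 < x → x < n → f x = g x) : optionValues c f n = optionValues c g n := by
  ext v
  refine exists_congr fun d => and_congr_right fun hd => exists_congr fun l =>
    and_congr_right fun hlen => and_congr_right fun hpos => and_congr_right fun hsum => ?_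
  suffices l.map f = l.map g by rw [this]
  refine List.map_congr_left fun x hx => hfg x (hpos x hx) ?_
  have hd : 0 < d := by
    simp only [Finset.mem_insert, Finset.mem_singleton] at hd
    omega
  have h1 := (List.perm_cons_erase hx).sum_eq
  have h2 := List.length_erase_of_mem hx
  have h3 : (l.erase x).length ≤ (l.erase x).sum :=
    List.length_le_sum_of_one_le _ fun y hy => hpos y (List.mem_of_mem_erase hy)
  rw [List.sum_cons] at h1
  omega

theorem cutGAux_eq (c : ℕ) (hc : 2 ≤ c) (fuel n : ℕ) (hn : 0 < n) (hle : n ≤ fuel) :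
    cutGAux {1, 2 * c} fuel n = claimedVal c n := by
  induction fuel generalizing n with
  | zero => omega
  | succ fuel ih =>
    change mex (optionValues c (cutGAux {1, 2 * c} fuel) n) = _
    rw [optionValues_congr c n (by omega) _ (claimedVal c)
      fun x hx hxn => ih x hx (by omega), mex_optionValues c n hc hn]

theorem cutG_eq (c n : ℕ) (hc : 2 ≤ c) (hn : 0 < n) : cutG {1, 2 * c} n = claimedVal c n :=
  cutGAux_eq c hc n n hn le_rfl

theorem claimedVal_add_period (c n : ℕ) (hc : 0 < c) (hn : 0 < n) :
    claimedVal c (n + 12 * c) = claimedVal c n + 8 := by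
  obtain ⟨m, rfl⟩ : ∃ m, n = m + 1 := ⟨n - 1, by omega⟩
  have hlt := baseVal_lt c (m % (12 * c))
  have hp : m % 2 < 8 := by omega
  rw [claimedVal, claimedVal, show m + 1 + 12 * c - 1 = m + 12 * c by omega, Nat.add_sub_cancel,
    flatVal, flatVal, Nat.add_mod_right, Nat.add_div_right _ (by omega),
    show (m + 12 * c) % 2 = m % 2 by omega]
  have h1 := mul_eight_add_xor (m / (12 * c)) 0 _ _ hlt hp
  have h2 := mul_eight_add_xor (m / (12 * c) + 1) 0 _ _ hlt hp
  rw [mul_zero, zero_add, Nat.xor_zero] at h1 h2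
  rw [h1, h2]
  omega

end CutPeriodic

/-- The nim-sequence of CUT for `C = {1, 2c}`, `c ≥ 2`, is arithmetic-periodic with
period `12c` and saltus `8`, with the first period as stated. -/
theorem cut_arithmetic_periodic (c : ℕ) (hc : 2 ≤ c) :
    (∀ n, 1 ≤ n → cutG {1, 2*c} (n + 12*c) = cutG {1, 2*c} n + 8) ∧
    (∀ n, 1 ≤ n → n ≤ 12*c →
      cutG {1, 2*c} n =
        if n ≤ 2*c then (if n % 2 = 1 then 0 else 1)
        else if n ≤ 4*c then (if n % 2 = 1 then 2 else 3)
        else if n = 4*c + 1 then 1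
        else if n = 4*c + 2 then 4
        else if n ≤ 6*c then (if n % 2 = 1 then 5 else 4)
        else if n ≤ 8*c then (if n % 2 = 1 then 3 else 2)
        else if n ≤ 10*c then (if n % 2 = 1 then 4 else 5)
        else (if n % 2 = 1 then 6 else 7)) := by
  refine ⟨fun n hn => ?_, fun n hn hle => ?_⟩
  · rw [CutPeriodic.cutG_eq c _ hc (by omega), CutPeriodic.cutG_eq c n hc hn,
      CutPeriodic.claimedVal_add_period c n (by omega) hn]
  · rw [CutPeriodic.cutG_eq c n hc hn, CutPeriodic.claimedVal,
      CutPeriodic.flatVal_of_lt c _ (by omega)]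
    have hpar : n % 2 = 1 - (n - 1) % 2 := by omega
    rcases Nat.mod_two_eq_zero_or_one (n - 1) with h | h <;>
    simp only [h, hpar, Nat.reduceSub, Nat.reduceEqDiff, ↓reduceIte] <;>
    split_ifs <;>
    rcases CutPeriodic.baseVal_cases c (n - 1) with ⟨h1, e⟩ | ⟨h1, h2, e⟩ | ⟨h1, e⟩ | ⟨h1, h2, e⟩ |
      ⟨h1, h2, e⟩ | ⟨h1, h2, e⟩ | ⟨h1, e⟩ <;>
    simp only [e, Nat.reduceXor] <;> omega
end

section
/- Let G : ℕ → ℕ, let P ≥ 1, let t > 1 and s = 2^t. Suppose that G(n) < s for all 1 ≤ n ≤ P and that G(n) = G(n − P) + s for all n > P. Let d ≥ 0 and for each 0 ≤ i ≤ d let hᵢ = kᵢ·P + rᵢ and h'ᵢ = kᵢ·P + r'ᵢ where kᵢ ≥ 0 and 1 ≤ rᵢ, r'ᵢ ≤ P. Then G(h₀) XOR G(h₁) XOR ⋯ XOR G(h_d) = G(h'₀) XOR G(h'₁) XOR ⋯ XOR G(h'_d) if and only if G(r₀) XOR G(r₁) XOR ⋯ XOR G(r_d) = G(r'₀) XOR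 G(r'₁) XOR ⋯ XOR G(r'_d). -/
theorem List.foldr_xor_map_xor {ι : Type*} (l : List ι) (f g : ι → ℕ) :
    (l.map (fun i => f i ^^^ g i)).foldr (· ^^^ ·) 0 =
      (l.map f).foldr (· ^^^ ·) 0 ^^^ (l.map g).foldr (· ^^^ ·) 0 := by
  induction l with
  | nil => simp
  | cons a l ih =>
    simp only [List.map_cons, List.foldr_cons, ih]
    ac_rfl

theorem Nat.two_pow_mul_add_eq_xor (t a : ℕ) {b : ℕ} (hb : b < 2 ^ t) :
    2 ^ t * a + b = 2 ^ t * a ^^^ b := by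
  refine Nat.eq_of_testBit_eq fun j => ?_
  rw [Nat.testBit_two_pow_mul_add a hb, Nat.testBit_xor, Nat.testBit_two_pow_mul]
  by_cases hj : j < t
  · simp [hj, Nat.not_le.mpr hj]
  · have hle : t ≤ j := Nat.not_lt.mp hj
    have : b.testBit j = false :=
      Nat.testBit_lt_two_pow (hb.trans_le (Nat.pow_le_pow_right two_pos hle))
    simp [hj, hle, this]

theorem arithmetic_periodic_apply {G : ℕ → ℕ} {P s : ℕ}
    (hper : ∀ n, P < n → G n = G (n - P) + s) (k : ℕ) {r : ℕ} (hr : 1 ≤ r) :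
    G (k * P + r) = s * k + G r := by
  induction k with
  | zero => simp
  | succ k ih =>
    have hsub : (k + 1) * P + r - P = k * P + r := by
      rw [Nat.succ_mul]
      omega
    rw [hper _ (by rw [Nat.succ_mul]; omega), hsub, ih]
    ring

theorem foldr_xor_arithmetic_periodic {G : ℕ → ℕ} {P t : ℕ}
    (hbound : ∀ n, 1 ≤ n → n ≤ P → G n < 2 ^ t)
    (hper : ∀ n, P < n → G n = G (n - P) + 2 ^ t)
    {ι : Type*} (l : List ι) (k r h : ι → ℕ)
    (hr : ∀ i ∈ l, 1 ≤ r i ∧ r i ≤ P) (hh : ∀ i ∈ l, h i = k i * P + r i) :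
    (l.map (fun i => G (h i))).foldr (· ^^^ ·) 0 =
      (l.map (fun i => 2 ^ t * k i)).foldr (· ^^^ ·) 0 ^^^
        (l.map (fun i => G (r i))).foldr (· ^^^ ·) 0 := by
  rw [← List.foldr_xor_map_xor]
  congr 1
  refine List.map_congr_left fun i hi => ?_
  obtain ⟨hpos, hle⟩ := hr i hi
  rw [hh i hi, arithmetic_periodic_apply hper _ hpos,
    Nat.two_pow_mul_add_eq_xor t _ (hbound _ hpos hle)]

/-- Lemma on arithmetic-periodic sequences with a power-of-two saltus:
the nim-sums of the `G`-values of two options with the same quotients agree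
iff the nim-sums of the `G`-values of the remainders agree. -/
theorem xor_eq_iff_remainders_xor_eq (G : ℕ → ℕ) (P : ℕ) (hP : 1 ≤ P)
    (t : ℕ) (ht : 1 < t) (s : ℕ) (hs : s = 2 ^ t)
    (hbound : ∀ n, 1 ≤ n → n ≤ P → G n < s)
    (hper : ∀ n, P < n → G n = G (n - P) + s)
    (d : ℕ) (k r r' h h' : ℕ → ℕ)
    (hr : ∀ i ≤ d, 1 ≤ r i ∧ r i ≤ P)
    (hr' : ∀ i ≤ d, 1 ≤ r' i ∧ r' i ≤ P)
    (hh : ∀ i ≤ d, h i = k i * P + r i)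
    (hh' : ∀ i ≤ d, h' i = k i * P + r' i) :
    ((List.range (d+1)).map (fun i => G (h i))).foldr (· ^^^ ·) 0 =
        ((List.range (d+1)).map (fun i => G (h' i))).foldr (· ^^^ ·) 0 ↔
      ((List.range (d+1)).map (fun i => G (r i))).foldr (· ^^^ ·) 0 =
        ((List.range (d+1)).map (fun i => G (r' i))).foldr (· ^^^ ·) 0 := by
  subst hs
  have hmem : ∀ i ∈ List.range (d + 1), i ≤ d := fun i hi =>
    Nat.le_of_lt_succ (List.mem_range.mp hi)
  rw [foldr_xor_arithmetic_periodic hbound hper _ k r h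
      (fun i hi => hr i (hmem i hi)) (fun i hi => hh i (hmem i hi)),
    foldr_xor_arithmetic_periodic hbound hper _ k r' h'
      (fun i hi => hr' i (hmem i hi)) (fun i hi => hh' i (hmem i hi)),
    Nat.xor_right_inj]
end

section
/- Let c ≥ 2 be an integer and C = {1, 2c}. For every n ≥ 1 with n ≢ 0 (mod 2c) and n ≢ 4c+1 (mod 12c), G_C(n+1) = G_C(n) XOR 1. -/
theorem mex_eq {S : Set ℕ} {v : ℕ} (hv : v ∉ S) (hlt : ∀ u < v, u ∈ S) : mex S = v := by
  refine le_antisymm (Nat.sInf_le hv) (le_csInf ⟨v, hv⟩ fun u hu => ?_)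
  by_contra h
  exact hu (hlt u (not_le.mp h))

/-- The three low bits of the nim-value of a pile of size `12cq + 2cb + r + 1`. -/
def cutLow : ℕ → ℕ → ℕ
  | 0, r => r % 2
  | 1, r => 2 + r % 2
  | 2, r => if r = 0 then 1 else 5 - r % 2
  | 3, r => 3 - r % 2
  | 4, r => 4 + r % 2
  | _, r => 6 + r % 2

/-- Closed form for the nim-value of a pile of size `m + 1`. -/
def cutValue (c m : ℕ) : ℕ :=
  8 * (m / (12 * c)) + cutLow (m % (12 * c) / (2 * c)) (m % (2 * c))

/-- Representative in `{0, 1, 2}` of a residue, keeping its parity and whether it vanishes. -/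
def residueClass (r : ℕ) : ℕ := if r = 0 then 0 else 2 - r % 2

theorem residueClass_lt (r : ℕ) : residueClass r < 3 := by
  unfold residueClass; split <;> omega

theorem residueClass_mod_two (r : ℕ) : residueClass r % 2 = r % 2 := by
  unfold residueClass; split <;> omega

theorem residueClass_eq_zero {r : ℕ} : residueClass r = 0 ↔ r = 0 := by
  unfold residueClass; split <;> omega

theorem cutLow_residueClass (b r : ℕ) : cutLow b (residueClass r) = cutLow b r := by
  unfold cutLow
  split <;> simp only [residueClass_mod_two, residueClass_eq_zero]

theorem cutLow_lt (b r : ℕ) : cutLow b r < 8 := by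
  unfold cutLow; split <;> (try split) <;> omega

theorem cutValue_eq {c q b r : ℕ} (hb : b < 6) (hr : r < 2 * c) :
    cutValue c (12 * (c * q) + 2 * (c * b) + r) = 8 * q + cutLow b r := by
  have hlt : 2 * (c * b) + r < 12 * c := by nlinarith
  have e1 : (12 * (c * q) + 2 * (c * b) + r) / (12 * c) = q := by
    rw [show 12 * (c * q) + 2 * (c * b) + r = 2 * (c * b) + r + 12 * c * q by ring,
      Nat.add_mul_div_left _ _ (by omega), Nat.div_eq_of_lt hlt, zero_add]
  have e2 : (12 * (c * q) + 2 * (c * b) + r) % (12 * c) = 2 * (c * b) + r := by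
    rw [show 12 * (c * q) + 2 * (c * b) + r = 2 * (c * b) + r + 12 * c * q by ring,
      Nat.add_mul_mod_self_left, Nat.mod_eq_of_lt hlt]
  have e3 : (2 * (c * b) + r) / (2 * c) = b := by
    rw [show 2 * (c * b) + r = r + 2 * c * b by ring, Nat.add_mul_div_left _ _ (by omega),
      Nat.div_eq_of_lt hr, zero_add]
  have e4 : (12 * (c * q) + 2 * (c * b) + r) % (2 * c) = r := by
    rw [show 12 * (c * q) + 2 * (c * b) + r = r + 2 * c * (6 * q + b) by ring,
      Nat.add_mul_mod_self_left, Nat.mod_eq_of_lt hr]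
  rw [cutValue, e1, e2, e3, e4]

theorem exists_block_decomp {c : ℕ} (hc : 0 < c) (m : ℕ) :
    ∃ q b r, b < 6 ∧ r < 2 * c ∧ m = 12 * (c * q) + 2 * (c * b) + r := by
  refine ⟨m / (12 * c), m % (12 * c) / (2 * c), m % (12 * c) % (2 * c), ?_, ?_, ?_⟩
  · rw [Nat.div_lt_iff_lt_mul (by omega)]
    have := Nat.mod_lt m (show 0 < 12 * c by omega)
    omega
  · exact Nat.mod_lt _ (by omega)
  · have h1 := Nat.div_add_mod m (12 * c)
    have h2 := Nat.div_add_mod (m % (12 * c)) (2 * c)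
    rw [mul_assoc] at h1 h2
    omega

theorem cutValue_zero {c : ℕ} (hc : 0 < c) : cutValue c 0 = 0 := by
  simpa [cutLow] using cutValue_eq (c := c) (q := 0) (b := 0) (r := 0) (by omega) (by omega)

theorem xor_eight_mul_add {a b x y : ℕ} (hx : x < 8) (hy : y < 8) :
    (8 * a + x) ^^^ (8 * b + y) = 8 * (a ^^^ b) + (x ^^^ y) := by
  have hd := Nat.xor_div_two_pow (a := 8 * a + x) (b := 8 * b + y) (n := 3)
  have hm := Nat.xor_mod_two_pow (a := 8 * a + x) (b := 8 * b + y) (n := 3)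
  rw [show 2 ^ 3 = 8 by rfl, show (8 * a + x) / 8 = a by omega,
    show (8 * b + y) / 8 = b by omega] at hd
  rw [show 2 ^ 3 = 8 by rfl, show (8 * a + x) % 8 = x by omega,
    show (8 * b + y) % 8 = y by omega] at hm
  omega

theorem xor_le_add (a b : ℕ) : a ^^^ b ≤ a + b := by
  induction a using Nat.strong_induction_on generalizing b with
  | _ a ih =>
    rcases Nat.eq_zero_or_pos a with rfl | ha
    · simp
    have h := ih (a / 2) (by omega) (b / 2)
    have hd : (a ^^^ b) / 2 = a / 2 ^^^ b / 2 := by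
      simpa using Nat.xor_div_two_pow (a := a) (b := b) (n := 1)
    have hm := Nat.xor_mod_two_eq (m := a) (n := b)
    omega

theorem cutLow_pair_ne : ∀ (b₁ b₂ : Fin 6) (s₁ s₂ : Fin 3) (k : Fin 2) (s : Fin 3),
    b₁.val + b₂ + k < 6 → (s₁.val + s₂ + 1) % 2 = s % 2 → (s.val = 0 → k.val = 1) →
    cutLow b₁ s₁ ^^^ cutLow b₂ s₂ ≠ cutLow (b₁ + b₂ + k) s := by
  decide

theorem cutValue_pair_ne {c : ℕ} (hc : 0 < c) (m₁ m₂ : ℕ) :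
    cutValue c m₁ ^^^ cutValue c m₂ ≠ cutValue c (m₁ + m₂ + 1) := by
  obtain ⟨q₁, b₁, r₁, hb₁, hr₁, rfl⟩ := exists_block_decomp hc m₁
  obtain ⟨q₂, b₂, r₂, hb₂, hr₂, rfl⟩ := exists_block_decomp hc m₂
  rw [cutValue_eq hb₁ hr₁, cutValue_eq hb₂ hr₂,
    xor_eight_mul_add (cutLow_lt _ _) (cutLow_lt _ _)]
  obtain ⟨k, r, hk, hr, hkr⟩ : ∃ k r, k < 2 ∧ r < 2 * c ∧ r₁ + r₂ + 1 = 2 * (c * k) + r := by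
    by_cases h : r₁ + r₂ + 1 < 2 * c
    · exact ⟨0, r₁ + r₂ + 1, by omega, h, by omega⟩
    · exact ⟨1, r₁ + r₂ + 1 - 2 * c, by omega, by omega, by omega⟩
  have hxor := xor_le_add q₁ q₂
  have hlow : cutLow b₁ r₁ ^^^ cutLow b₂ r₂ < 8 :=
    Nat.xor_lt_two_pow (n := 3) (cutLow_lt _ _) (cutLow_lt _ _)
  by_cases hsum : b₁ + b₂ + k < 6
  · rw [show 12 * (c * q₁) + 2 * (c * b₁) + r₁ + (12 * (c * q₂) + 2 * (c * b₂) + r₂) + 1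
        = 12 * (c * (q₁ + q₂)) + 2 * (c * (b₁ + b₂ + k)) + r by
        simp only [mul_add]; omega, cutValue_eq hsum hr]
    have := cutLow_pair_ne ⟨b₁, hb₁⟩ ⟨b₂, hb₂⟩ ⟨_, residueClass_lt r₁⟩ ⟨_, residueClass_lt r₂⟩
      ⟨k, hk⟩ ⟨_, residueClass_lt r⟩ hsum
      (by have := residueClass_mod_two r₁
          have := residueClass_mod_two r₂
          have := residueClass_mod_two r
          dsimp only
          omega)
      (by rw [residueClass_eq_zero]
          rintro rfl
          change k = 1
          interval_cases k <;> omega)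
    simp only [cutLow_residueClass] at this
    have := cutLow_lt (b₁ + b₂ + k) r
    omega
  · obtain ⟨b, hb⟩ : ∃ b, b₁ + b₂ + k = 6 + b := ⟨_, (Nat.add_sub_of_le (by omega)).symm⟩
    have hcb : c * b₁ + c * b₂ + c * k = 6 * c + c * b := by
      rw [← mul_add, ← mul_add, hb]; ring
    rw [show 12 * (c * q₁) + 2 * (c * b₁) + r₁ + (12 * (c * q₂) + 2 * (c * b₂) + r₂) + 1
        = 12 * (c * (q₁ + q₂ + 1)) + 2 * (c * b) + r by
        simp only [mul_add]; omega, cutValue_eq (by omega) hr]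
    omega

/-- Constraint on the xor `y` of the low bits of a list of values whose blocks add up to `B ≤ 4`
and whose residues add up to a number of parity `p`. -/
def LowReachable (y B p : ℕ) : Prop :=
  y / 2 % 2 = B % 2 ∧ (B ≤ 1 → y / 2 ≤ 1 ∧ (y + p) % 2 = 0) ∧
    (B ≤ 3 → 2 ≤ y / 2 → (y + p) % 2 = 1)

instance (y B p : ℕ) : Decidable (LowReachable y B p) := by
  unfold LowReachable; infer_instance

theorem LowReachable.step : ∀ (B b : Fin 5) (y : Fin 8) (p : Fin 2) (s : Fin 3), B.val + b < 5 →
    LowReachable y B p → LowReachable (cutLow b s ^^^ y) (b + B) ((s.val + p) % 2) := by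
  decide

theorem LowReachable.ne_cutLow : ∀ (B : Fin 5) (b : Fin 6) (y : Fin 8) (s : Fin 3), B.val + 1 ≤ b →
    LowReachable y B (s.val % 2) → y.val ≠ cutLow b s := by
  decide

theorem lowReachable_of_list {c : ℕ} (hc : 0 < c) (l : List ℕ) (hl : ∀ x ∈ l, 0 < x) :
    ∃ Q B R y z, l.sum = 12 * (c * Q) + 2 * (c * B) + R + l.length ∧
      (l.map fun x => cutValue c (x - 1)).foldr (· ^^^ ·) 0 = 8 * z + y ∧ y < 8 ∧ z ≤ Q ∧
      (B < 5 → LowReachable y B (R % 2)) := by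
  induction l with
  | nil => exact ⟨0, 0, 0, 0, 0, by simp, by simp, by omega, le_rfl, fun _ => by decide⟩
  | cons x l ih =>
    obtain ⟨Q, B, R, y, z, hsum, hxor, hy, hz, hT⟩ := ih fun x hx => hl x (by simp [hx])
    have hx : 0 < x := hl x (by simp)
    obtain ⟨q, b, r, hb, hr, hm⟩ := exists_block_decomp hc (x - 1)
    refine ⟨q + Q, b + B, r + R, cutLow b r ^^^ y, q ^^^ z, ?_, ?_, ?_, ?_, fun hB => ?_⟩
    · simp only [List.sum_cons, List.length_cons, mul_add]
      omega
    · simp only [List.map_cons, List.foldr_cons]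
      rw [hxor, hm, cutValue_eq hb hr, xor_eight_mul_add (cutLow_lt _ _) hy]
    · exact Nat.xor_lt_two_pow (n := 3) (cutLow_lt _ _) hy
    · exact (xor_le_add _ _).trans (by omega)
    · have := LowReachable.step ⟨B, by omega⟩ ⟨b, by omega⟩ ⟨y, hy⟩ ⟨R % 2, by omega⟩
        ⟨_, residueClass_lt r⟩ (show B + b < 5 by omega) (hT (by omega))
      rw [cutLow_residueClass, Nat.add_mod, residueClass_mod_two, Nat.mod_mod,
        ← Nat.add_mod] at this
      exact this

theorem cutValue_list_ne {c : ℕ} (hc : 0 < c) {l : List ℕ} (hl : ∀ x ∈ l, 0 < x)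
    (hlen : l.length = 2 * c + 1) :
    (l.map fun x => cutValue c (x - 1)).foldr (· ^^^ ·) 0 ≠ cutValue c (l.sum - 1) := by
  obtain ⟨Q, B, R, y, z, hsum, hxor, hy, hz, hT⟩ := lowReachable_of_list hc l hl
  obtain ⟨q, b, r, hb, hr, hm⟩ := exists_block_decomp hc (l.sum - 1)
  rw [hxor, hm, cutValue_eq hb hr]
  intro h
  have hlow := cutLow_lt b r
  have hzq : z = q := by omega
  have hQ : Q = q := by
    refine le_antisymm ?_ (hzq ▸ hz)
    by_contra! hlt
    obtain ⟨t, rfl⟩ := Nat.exists_eq_add_of_lt hlt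
    have : c * (b + 1) ≤ c * 6 := Nat.mul_le_mul_left _ (by omega)
    simp only [mul_add] at hsum this
    omega
  subst hQ
  have hBb : B + 1 ≤ b := by
    by_contra! hlt
    have : c * b ≤ c * B := Nat.mul_le_mul_left _ (by omega)
    omega
  have hR : R % 2 = r % 2 := by omega
  have := LowReachable.ne_cutLow ⟨B, by omega⟩ ⟨b, hb⟩ ⟨y, hy⟩ ⟨_, residueClass_lt r⟩ hBb
    (by rw [residueClass_mod_two, ← hR]; exact hT (by omega))
  dsimp only at this
  rw [cutLow_residueClass] at this
  omega

/-- The least mass of parity `p` of two piles whose values have xor `u < 8`. -/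
def minMass (c : ℕ) : ℕ → ℕ → ℕ
  | 0, 0 => 0
  | 0, _ => 4 * c + 1
  | 1, 0 => 4 * c
  | 1, _ => 1
  | 2, 0 => 2 * c
  | 2, _ => 6 * c + 1
  | 3, 0 => 6 * c
  | 3, _ => 2 * c + 1
  | 4, 0 => 8 * c
  | 4, _ => 4 * c + 1
  | 5, 0 => 4 * c + 2
  | 5, _ => 8 * c + 1
  | 6, 0 => 10 * c
  | 6, _ => 6 * c + 1
  | _, 0 => 6 * c + 2
  | _, _ => 10 * c + 1

theorem cutValue_pair_xor {c q b₁ r₁ b₂ r₂ : ℕ} (hb₁ : b₁ < 6) (hb₂ : b₂ < 6) (hr₁ : r₁ < 2 * c)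
    (hr₂ : r₂ < 2 * c) :
    cutValue c (12 * (c * q) + 2 * (c * b₁) + r₁) ^^^ cutValue c (2 * (c * b₂) + r₂) =
      8 * q + (cutLow b₁ r₁ ^^^ cutLow b₂ r₂) := by
  have h := cutValue_eq (q := 0) hb₂ hr₂
  simp only [mul_zero, zero_add] at h
  rw [cutValue_eq hb₁ hr₁, h]
  simpa using xor_eight_mul_add (a := q) (b := 0) (cutLow_lt b₁ r₁) (cutLow_lt b₂ r₂)

theorem exists_pair_minMass {c : ℕ} (hc : 2 ≤ c) (w : ℕ) {u p : ℕ} (hu : u < 8) (hp : p < 2) :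
    ∃ a b, a + b = 12 * (c * w) + minMass c u p ∧ minMass c u p % 2 = p ∧
      cutValue c a ^^^ cutValue c b = 8 * w + u := by
  have key : ∃ b₁ r₁ b₂ r₂, b₁ < 6 ∧ b₂ < 6 ∧ r₁ < 3 ∧ r₂ < 3 ∧
      2 * (c * b₁) + r₁ + (2 * (c * b₂) + r₂) = minMass c u p ∧ minMass c u p % 2 = p ∧
      cutLow b₁ r₁ ^^^ cutLow b₂ r₂ = u := by
    interval_cases u <;> interval_cases p <;> simp only [minMass]
    · exact ⟨0, 0, 0, 0, by simp [cutLow]⟩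
    · exact ⟨0, 1, 2, 0, by simp [cutLow]; omega⟩
    · exact ⟨2, 0, 0, 0, by simp [cutLow]; omega⟩
    · exact ⟨0, 1, 0, 0, by simp [cutLow]⟩
    · exact ⟨1, 0, 0, 0, by simp [cutLow]⟩
    · exact ⟨3, 1, 0, 0, by simp [cutLow]; omega⟩
    · exact ⟨3, 0, 0, 0, by simp [cutLow]; omega⟩
    · exact ⟨1, 1, 0, 0, by simp [cutLow]⟩
    · exact ⟨4, 0, 0, 0, by simp [cutLow]; omega⟩
    · exact ⟨2, 1, 0, 0, by simp [cutLow]; omega⟩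
    · exact ⟨2, 2, 0, 0, by simp [cutLow]; omega⟩
    · exact ⟨4, 1, 0, 0, by simp [cutLow]; omega⟩
    · exact ⟨5, 0, 0, 0, by simp [cutLow]; omega⟩
    · exact ⟨1, 0, 2, 1, by simp [cutLow]; omega⟩
    · exact ⟨1, 0, 2, 2, by simp [cutLow]; omega⟩
    · exact ⟨5, 1, 0, 0, by simp [cutLow]; omega⟩
  obtain ⟨b₁, r₁, b₂, r₂, hb₁, hb₂, hr₁, hr₂, hmass, hpar, hlow⟩ := key
  refine ⟨12 * (c * w) + 2 * (c * b₁) + r₁, 2 * (c * b₂) + r₂, by omega, hpar, ?_⟩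
  rw [cutValue_pair_xor hb₁ hb₂ (by omega) (by omega), hlow]

/-- The option values of a pile of size `m + 1`, computed with `cutValue`. -/
def IsOptionValue (c m v : ℕ) : Prop :=
  ∃ d ∈ ({1, 2 * c} : Finset ℕ), ∃ l : List ℕ, l.length = d + 1 ∧ (∀ x ∈ l, 0 < x) ∧
    l.sum = m + 1 ∧ (l.map fun x => cutValue c (x - 1)).foldr (· ^^^ ·) 0 = v

theorem IsOptionValue.pair {c m₁ m₂ m v : ℕ} (hm : m₁ + m₂ + 1 = m)
    (hv : cutValue c m₁ ^^^ cutValue c m₂ = v) : IsOptionValue c m v := by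
  refine ⟨1, by simp, [m₁ + 1, m₂ + 1], rfl, by simp, ?_, by simpa using hv⟩
  simp only [List.sum_cons, List.sum_nil]
  omega

theorem foldr_xor_replicate_zero (k : ℕ) : (List.replicate k 0).foldr (· ^^^ ·) 0 = 0 := by
  induction k with
  | zero => rfl
  | succ k ih => simp [List.replicate_succ, ih]

theorem IsOptionValue.of_minMass {c : ℕ} (hc : 2 ≤ c) {m w u M : ℕ} (hu : u < 8)
    (hm : m = 12 * (c * w) + 2 * c + M) (hM : minMass c u (M % 2) ≤ M) :
    IsOptionValue c m (8 * w + u) := by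
  obtain ⟨a, b, hab, hpar, hv⟩ := exists_pair_minMass hc w hu (Nat.mod_lt M two_pos)
  obtain ⟨x, hx⟩ : ∃ x, M = minMass c u (M % 2) + 2 * x :=
    ⟨(M - minMass c u (M % 2)) / 2, by omega⟩
  refine ⟨2 * c, by simp,
    (x + 1) :: (x + 1) :: (a + 1) :: (b + 1) :: List.replicate (2 * c - 3) 1, ?_, ?_, ?_, ?_⟩
  · simp only [List.length_cons, List.length_replicate]; omega
  · simp only [List.mem_cons, List.mem_replicate]; omega
  · simp only [List.sum_cons, List.sum_replicate, smul_eq_mul]; omega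
  · simp only [List.map_cons, List.foldr_cons, List.map_replicate, Nat.add_sub_cancel,
      Nat.sub_self, cutValue_zero (show 0 < c by omega), foldr_xor_replicate_zero, Nat.xor_zero]
    rw [← Nat.xor_assoc, Nat.xor_self, Nat.zero_xor, hv]

theorem minMass_le {c u M : ℕ} (hM : 10 * c ≤ M) (hc : 2 ≤ c) : minMass c u (M % 2) ≤ M := by
  rcases Nat.mod_two_eq_zero_or_one M with h | h <;> rw [h] <;> unfold minMass <;> split <;>
    first | omega | simp_all

theorem IsOptionValue.of_blocks {c q b r v b₁ r₁ b₂ r₂ : ℕ} (hb₁ : b₁ < 6) (hb₂ : b₂ < 6)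
    (hr₁ : r₁ < 2 * c) (hr₂ : r₂ < 2 * c)
    (hm : 2 * (c * b₁) + r₁ + (2 * (c * b₂) + r₂) + 1 = 2 * (c * b) + r)
    (hv : cutLow b₁ r₁ ^^^ cutLow b₂ r₂ = v) :
    IsOptionValue c (12 * (c * q) + 2 * (c * b) + r) (8 * q + v) := by
  refine IsOptionValue.pair (m₁ := 12 * (c * q) + 2 * (c * b₁) + r₁)
    (m₂ := 2 * (c * b₂) + r₂) (by omega) ?_
  rw [cutValue_pair_xor hb₁ hb₂ hr₁ hr₂, hv]

theorem isOptionValue_of_lt_cutLow {c : ℕ} (hc : 2 ≤ c) {q b r u : ℕ} (hb : b < 6)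
    (hr : r < 2 * c) (hu : u < cutLow b r) :
    IsOptionValue c (12 * (c * q) + 2 * (c * b) + r) (8 * q + u) := by
  have hodd : (2 * c - 1) % 2 = 1 := by omega
  have large (b' : ℕ) (hb' : b = b' + 1) (p : ℕ) (hp : r % 2 = p)
      (hM : minMass c u p ≤ 2 * (c * b') + r) :
      IsOptionValue c (12 * (c * q) + 2 * (c * b) + r) (8 * q + u) := by
    have hu8 := hu.trans (cutLow_lt b r)
    have hpar : (2 * (c * b') + r) % 2 = p := by omega
    refine IsOptionValue.of_minMass (M := 2 * (c * b') + r) hc hu8 ?_ (by rwa [hpar])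
    rw [hb', mul_add]
    omega
  have small (b₁ r₁ b₂ r₂ : ℕ) (hb₁ : b₁ < 6) (hb₂ : b₂ < 6) (hr₁ : r₁ < 2 * c)
      (hr₂ : r₂ < 2 * c)
      (hm : 2 * (c * b₁) + r₁ + (2 * (c * b₂) + r₂) + 1 = 2 * (c * b) + r)
      (hv : cutLow b₁ r₁ ^^^ cutLow b₂ r₂ = u) :=
    IsOptionValue.of_blocks (q := q) hb₁ hb₂ hr₁ hr₂ hm hv
  rcases Nat.mod_two_eq_zero_or_one r with hpar | hpar
  · interval_cases b <;> simp only [cutLow, hpar] at hu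
    · omega
    · interval_cases u
      · exact large 0 rfl 0 hpar (by simp [minMass])
      · exact small 0 (2 * c - 1) 0 r (by omega) (by omega) (by omega) (by omega) (by omega)
          (by simp [cutLow, hodd, hpar])
    · split at hu
      · interval_cases u
        exact large 1 rfl 0 hpar (by simp [minMass])
      · have hpr : (r - 1) % 2 = 1 := by omega
        interval_cases u
        · exact large 1 rfl 0 hpar (by simp [minMass])
        · exact small 1 (r - 1) 1 0 (by omega) (by omega) (by omega) (by omega) (by omega)
            (by simp [cutLow, hpr])
        · exact large 1 rfl 0 hpar (by simp only [minMass]; omega)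
        · exact small 1 r 0 (2 * c - 1) (by omega) (by omega) (by omega) (by omega) (by omega)
            (by simp [cutLow, hodd, hpar])
        · exact small 2 (r - 1) 0 0 (by omega) (by omega) (by omega) (by omega) (by omega)
            (by simp only [cutLow, if_neg (show r - 1 ≠ 0 by omega), hpr]; rfl)
    · refine large 2 rfl 0 hpar ?_
      interval_cases u <;> simp only [minMass] <;> omega
    · refine large 3 rfl 0 hpar ?_
      interval_cases u <;> simp only [minMass] <;> omega
    · refine large 4 rfl 0 hpar ?_
      interval_cases u <;> simp only [minMass] <;> omega
  · have hpr : (r - 1) % 2 = 0 := by omega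
    have hr0 : r ≠ 0 := by omega
    interval_cases b <;> simp only [cutLow, hpar, if_neg hr0] at hu
    · interval_cases u
      exact small 0 (r - 1) 0 0 (by omega) (by omega) (by omega) (by omega) (by omega)
        (by simp [cutLow, hpr])
    · interval_cases u
      · exact small 0 (2 * c - 1) 0 r (by omega) (by omega) (by omega) (by omega) (by omega)
          (by simp [cutLow, hodd, hpar])
      · exact large 0 rfl 1 hpar (by simp only [minMass]; omega)
      · exact small 1 (r - 1) 0 0 (by omega) (by omega) (by omega) (by omega) (by omega)
          (by simp [cutLow, hpr])
    · interval_cases u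
      · exact small 1 (r - 1) 1 0 (by omega) (by omega) (by omega) (by omega) (by omega)
          (by simp [cutLow, hpr])
      · exact large 1 rfl 1 hpar (by simp only [minMass]; omega)
      · exact small 1 (2 * c - 1) 0 r (by omega) (by omega) (by omega) (by omega) (by omega)
          (by simp [cutLow, hodd, hpar])
      · exact large 1 rfl 1 hpar (by simp only [minMass]; omega)
    · refine large 2 rfl 1 hpar ?_
      interval_cases u <;> simp only [minMass] <;> omega
    · refine large 3 rfl 1 hpar ?_
      interval_cases u <;> simp only [minMass] <;> omega
    · refine large 4 rfl 1 hpar ?_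
      interval_cases u <;> simp only [minMass] <;> omega

theorem isOptionValue_of_lt {c : ℕ} (hc : 2 ≤ c) {m v : ℕ} (hv : v < cutValue c m) :
    IsOptionValue c m v := by
  obtain ⟨q, b, r, hb, hr, rfl⟩ := exists_block_decomp (show 0 < c by omega) m
  rw [cutValue_eq hb hr] at hv
  have := cutLow_lt b r
  obtain ⟨w, u, hu, rfl⟩ : ∃ w u, u < 8 ∧ v = 8 * w + u :=
    ⟨v / 8, v % 8, by omega, by omega⟩
  rcases (show w ≤ q by omega).eq_or_lt with rfl | hlt
  · exact isOptionValue_of_lt_cutLow hc hb hr (by omega)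
  · obtain ⟨t, rfl⟩ := Nat.exists_eq_add_of_lt hlt
    refine IsOptionValue.of_minMass (M := 12 * (c * t) + 10 * c + 2 * (c * b) + r) hc hu ?_
      (minMass_le (by omega) hc)
    simp only [mul_add]
    omega

theorem not_isOptionValue_cutValue {c : ℕ} (hc : 0 < c) (m : ℕ) :
    ¬ IsOptionValue c m (cutValue c m) := by
  rintro ⟨d, hd, l, hlen, hpos, hsum, hv⟩
  rcases (by simpa using hd : d = 1 ∨ d = 2 * c) with rfl | rfl
  · obtain ⟨x, y, rfl⟩ := List.length_eq_two.mp hlen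
    have hx : 0 < x := hpos x (by simp)
    have hy : 0 < y := hpos y (by simp)
    have := cutValue_pair_ne hc (x - 1) (y - 1)
    simp only [List.sum_cons, List.sum_nil] at hsum
    rw [show x - 1 + (y - 1) + 1 = m by omega] at this
    exact this (by simpa using hv)
  · have := cutValue_list_ne hc hpos hlen
    rw [hsum, Nat.add_sub_cancel] at this
    exact this hv

theorem lt_sum_of_mem {l : List ℕ} (hlen : 2 ≤ l.length) (hpos : ∀ x ∈ l, 0 < x) {x : ℕ}
    (hx : x ∈ l) : x < l.sum := by
  have hperm := List.perm_cons_erase hx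
  have hsum := hperm.sum_eq
  have hl := hperm.length_eq
  simp only [List.length_cons] at hl
  obtain ⟨y, hy⟩ := List.exists_mem_of_length_pos (l := l.erase x) (by omega)
  have := List.single_le_sum (l := l.erase x) (by simp) y hy
  have := hpos y (List.mem_of_mem_erase hy)
  simp only [List.sum_cons] at hsum
  omega

theorem cutGAux_eq_cutValue {c : ℕ} (hc : 2 ≤ c) (k m : ℕ) (hm : m < k) :
    cutGAux {1, 2 * c} k (m + 1) = cutValue c m := by
  induction k generalizing m with
  | zero => omega
  | succ k ih =>
    have hset : {v | ∃ d ∈ ({1, 2 * c} : Finset ℕ), ∃ l : List ℕ, l.length = d + 1 ∧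
        (∀ x ∈ l, 0 < x) ∧ l.sum = m + 1 ∧
        (l.map (cutGAux {1, 2 * c} k)).foldr (· ^^^ ·) 0 = v} = {v | IsOptionValue c m v} := by
      ext v
      simp only [Set.mem_ofPred_eq, IsOptionValue]
      refine exists_congr fun d => and_congr_right fun hd => exists_congr fun l =>
        and_congr_right fun hlen => and_congr_right fun hpos => and_congr_right fun hsum => ?_
      have hd' : 1 ≤ d := by
        rcases (by simpa using hd : d = 1 ∨ d = 2 * c) with rfl | rfl <;> omega
      rw [List.map_congr_left fun x hx => ?_]
      have hlt := lt_sum_of_mem (by omega) hpos hx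
      have hx0 := hpos x hx
      obtain ⟨y, rfl⟩ := Nat.exists_eq_add_of_lt hx0
      simpa using ih y (by omega)
    rw [cutGAux, hset]
    exact mex_eq (not_isOptionValue_cutValue (by omega) m) fun u hu => isOptionValue_of_lt hc hu

theorem cutLow_succ : ∀ (b : Fin 6) (s t : Fin 3), 0 < t.val → (s.val + 1) % 2 = t.val % 2 →
    (b.val = 2 → s.val ≠ 0) → cutLow b t = cutLow b s ^^^ 1 := by
  decide

/-- Observation (ob1): `G(n+1) = G(n) ⊕ 1` whenever `n ≢ 0 (mod 2c)` and
`n ≢ 4c+1 (mod 12c)`. -/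
theorem cut_ob1 (c : ℕ) (hc : 2 ≤ c) (n : ℕ) (hn : 1 ≤ n)
    (h1 : n % (2*c) ≠ 0) (h2 : n % (12*c) ≠ 4*c + 1) :
    cutG {1, 2*c} (n + 1) = cutG {1, 2*c} n ^^^ 1 := by
  obtain ⟨m, rfl⟩ := Nat.exists_eq_add_of_lt hn
  rw [zero_add] at *
  rw [cutG, cutG, cutGAux_eq_cutValue hc _ _ (by omega), cutGAux_eq_cutValue hc _ _ (by omega)]
  obtain ⟨q, b, r, hb, hr, rfl⟩ := exists_block_decomp (show 0 < c by omega) m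
  have hr' : r + 1 < 2 * c := by
    by_contra! h
    apply h1
    rw [show 12 * (c * q) + 2 * (c * b) + r + 1 = 2 * c * (6 * q + b + 1) by
      have : 2 * c * (6 * q + b + 1) = 12 * (c * q) + 2 * (c * b) + 2 * c := by ring
      omega, Nat.mul_mod_right]
  have hbr : b = 2 → r ≠ 0 := by
    rintro rfl rfl
    apply h2
    rw [show 12 * (c * q) + 2 * (c * 2) + 0 + 1 = 4 * c + 1 + 12 * c * q by ring,
      Nat.add_mul_mod_self_left, Nat.mod_eq_of_lt (by omega)]
  have hlow := cutLow_succ ⟨b, hb⟩ ⟨_, residueClass_lt r⟩ ⟨_, residueClass_lt (r + 1)⟩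
    (Nat.pos_of_ne_zero (by rw [Ne, residueClass_eq_zero]; omega))
    (by have := residueClass_mod_two r
        have := residueClass_mod_two (r + 1)
        dsimp only
        omega)
    (by rwa [Ne, residueClass_eq_zero])
  simp only [cutLow_residueClass] at hlow
  rw [add_assoc, cutValue_eq hb hr', cutValue_eq hb hr, hlow]
  simpa using (xor_eight_mul_add (a := q) (b := 0) (y := 1) (cutLow_lt b r) (by omega)).symm
end

section
/- Let c ≥ 2 and C = {1, 2c}. (i) Suppose O is a partition of n into p positive parts and O' is a partition of n' into p positive parts with ⌊O⌋ = ⌊O'⌋. If n ≡ n' (mod 2) then G_C(O) = G_C(O'), and otherwise G_C(O) = G_C(O') XOR 1. (ii) Conversely, suppose O is a partition of n into p positive parts, ⌊O⌋ is a partition of a, and ⌈O⌉ is a partition of b. If a ≤ n' ≤ b and n' ≡ n (mod 2), then there is a partition O' of n' into p positive parts with G_C(O') = G_C(O). -/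
/-- `m` is an innumber with respect to `c`. -/
def Innumber (c m : ℕ) : Prop := 0 < m ∧ (m % (2*c) = 1 ∨ m % (12*c) = 4*c + 2)

/-- `m` is an outnumber with respect to `c`. -/
def Outnumber (c m : ℕ) : Prop := 0 < m ∧ (m % (2*c) = 0 ∨ m % (12*c) = 4*c + 1)

/-- A partition is entering if all its parts are innumbers. -/
def Entering (c : ℕ) (l : List ℕ) : Prop := ∀ m ∈ l, Innumber c m

/-- A partition is exiting if all its parts are outnumbers. -/
def Exiting (c : ℕ) (l : List ℕ) : Prop := ∀ m ∈ l, Outnumber c m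

/-- The greatest innumber less than or equal to `h`. -/
noncomputable def floorIn (c h : ℕ) : ℕ := sSup {m | Innumber c m ∧ m ≤ h}

/-- The least outnumber greater than or equal to `h`. -/
noncomputable def ceilOut (c h : ℕ) : ℕ := sInf {m | Outnumber c m ∧ h ≤ m}

/-- The floor of a partition, with the exceptional case of three parts whose
floors are all congruent to `2` modulo `2c`. -/
noncomputable def floorPart (c : ℕ) (l : List ℕ) : List ℕ :=
  match l with
  | [h1, h2, h3] =>
      if floorIn c h1 % (2*c) = 2 % (2*c) ∧ floorIn c h2 % (2*c) = 2 % (2*c) ∧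
          floorIn c h3 % (2*c) = 2 % (2*c)
      then [floorIn c h1 - 1, floorIn c h2 - 1, floorIn c h3]
      else [floorIn c h1, floorIn c h2, floorIn c h3]
  | _ => l.map (floorIn c)

/-- The ceiling of a partition. -/
noncomputable def ceilPart (c : ℕ) (l : List ℕ) : List ℕ := l.map (ceilOut c)

theorem eight_mul_add_xor (a b x y : ℕ) (hx : x < 8) (hy : y < 8) :
    (8 * a + x) ^^^ (8 * b + y) = 8 * (a ^^^ b) + (x ^^^ y) := by
  have hd : ((8 * a + x) ^^^ (8 * b + y)) / 2 ^ 3 = a ^^^ b := by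
    rw [Nat.xor_div_two_pow]; congr 1 <;> omega
  have hm : ((8 * a + x) ^^^ (8 * b + y)) % 2 ^ 3 = x ^^^ y := by
    rw [Nat.xor_mod_two_pow]; congr 1 <;> omega
  omega

theorem xor_le_add_self : ∀ x y : ℕ, x ^^^ y ≤ x + y := by
  intro x
  induction x using Nat.strong_induction_on with
  | _ x ih =>
    intro y
    rcases Nat.eq_zero_or_pos x with rfl | hx
    · simp
    · have h1 := ih (x / 2) (by omega) (y / 2)
      have h2 := Nat.xor_div_two (a := x) (b := y)
      have h3 := Nat.xor_mod_two_eq (m := x) (n := y)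
      omega

/-- The nim-values of CUT with cut-set `{1, 2c}` on the first period `1, …, 12c`. -/
def periodVal (c m : ℕ) : ℕ :=
  if m ≤ 2 * c then (m + 1) % 2
  else if m ≤ 4 * c then 2 + (m + 1) % 2
  else if m = 4 * c + 1 then 1
  else if m ≤ 6 * c then 4 + m % 2
  else if m ≤ 8 * c then 2 + m % 2
  else if m ≤ 10 * c then 4 + (m + 1) % 2
  else 6 + (m + 1) % 2

/-- The closed form of the nim-values of CUT with cut-set `{1, 2c}`: arithmetic periodicity
with period `12c` and saltus `8`. -/
def pileVal (c n : ℕ) : ℕ :=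
  8 * ((n - 1) / (12 * c)) + periodVal c ((n - 1) % (12 * c) + 1)

/-- The nim-sum of the closed-form values over a list of piles. -/
def listVal (c : ℕ) (l : List ℕ) : ℕ := (l.map (pileVal c)).foldr (· ^^^ ·) 0

theorem periodVal_lt (c m : ℕ) : periodVal c m < 8 := by
  unfold periodVal; split_ifs <;> omega

theorem pileVal_add {c m : ℕ} (k : ℕ) (h0 : 1 ≤ m) (h1 : m ≤ 12 * c) :
    pileVal c (12 * (c * k) + m) = 8 * k + periodVal c m := by
  have e : 12 * (c * k) + m - 1 = (m - 1) + 12 * c * k := by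
    rw [mul_assoc]; omega
  unfold pileVal
  rw [e, Nat.add_mul_div_left _ _ (by omega), Nat.add_mul_mod_self_left,
    Nat.div_eq_of_lt (by omega), Nat.mod_eq_of_lt (by omega)]
  congr 2
  · omega
  · omega

theorem exists_period_decomp {c n : ℕ} (hc : 1 ≤ c) (hn : 1 ≤ n) :
    ∃ k m, 1 ≤ m ∧ m ≤ 12 * c ∧ n = 12 * (c * k) + m := by
  have h := Nat.div_add_mod (n - 1) (12 * c)
  have h2 := Nat.mod_lt (n - 1) (show 12 * c > 0 by omega)
  rw [mul_assoc] at h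
  exact ⟨(n - 1) / (12 * c), (n - 1) % (12 * c) + 1, by omega, by omega, by omega⟩

theorem pileVal_of_le {c m : ℕ} (h0 : 1 ≤ m) (h1 : m ≤ 12 * c) :
    pileVal c m = periodVal c m := by
  simpa using pileVal_add 0 h0 h1

@[simp] theorem listVal_nil (c : ℕ) : listVal c [] = 0 := rfl

@[simp] theorem listVal_cons (c a : ℕ) (l : List ℕ) :
    listVal c (a :: l) = pileVal c a ^^^ listVal c l := rfl

theorem pileVal_one {c : ℕ} (hc : 1 ≤ c) : pileVal c 1 = 0 := by
  rw [pileVal_of_le le_rfl (by omega), periodVal, if_pos (by omega)]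

theorem listVal_replicate_one {c : ℕ} (hc : 1 ≤ c) (k : ℕ) :
    listVal c (List.replicate k 1) = 0 := by
  induction k with
  | zero => rfl
  | succ k ih => simp [List.replicate_succ, ih, pileVal_one hc]

/-- The least block total that a list of piles with nim-value `w` modulo `8` and parity defect
`s` must have. -/
def blockCost (w s : ℕ) : ℕ :=
  if s = 0 then (if w < 4 then w / 2 else w / 2 + 2) else 2 + w / 2 % 2

theorem blockCost_xor_le : ∀ w < 8, ∀ w' < 8, ∀ s < 2, ∀ s' < 2,
    blockCost (w ^^^ w') ((s + s') % 2) ≤ blockCost w s + blockCost w' s' := by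
  decide

theorem pileVal_blockCost_le {c h : ℕ} (hc : 1 ≤ c) (hh : 1 ≤ h) :
    12 * (c * (pileVal c h / 8)) +
      2 * (c * blockCost (pileVal c h % 8) ((pileVal c h + h + 1) % 2)) + 1 ≤ h := by
  obtain ⟨k, m, h0, h1, rfl⟩ := exists_period_decomp hc hh
  have hlt := periodVal_lt c m
  rw [pileVal_add k h0 h1]
  have e1 : (8 * k + periodVal c m) / 8 = k := by omega
  have e2 : (8 * k + periodVal c m) % 8 = periodVal c m := by omega
  have e3 : (8 * k + periodVal c m + (12 * (c * k) + m) + 1) % 2 = (periodVal c m + m + 1) % 2 := by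
    omega
  rw [e1, e2, e3]
  have key : 2 * (c * blockCost (periodVal c m) ((periodVal c m + m + 1) % 2)) + 1 ≤ m := by
    obtain ⟨b, hb, hb'⟩ : ∃ b, blockCost (periodVal c m) ((periodVal c m + m + 1) % 2) = b ∧
        2 * (c * b) + 1 ≤ m := by
      refine ⟨_, rfl, ?_⟩
      have aux : ∀ b x, x = b → 2 * (c * b) + 1 ≤ m → 2 * (c * x) + 1 ≤ m := by
        rintro b x rfl h; exact h
      unfold periodVal blockCost
      split_ifs <;> first
        | omega
        | exact aux 0 _ (by omega) (by omega)
        | exact aux 1 _ (by omega) (by omega)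
        | exact aux 2 _ (by omega) (by omega)
        | exact aux 3 _ (by omega) (by omega)
        | exact aux 4 _ (by omega) (by omega)
        | exact aux 5 _ (by omega) (by omega)
    rw [hb]; exact hb'
  omega

theorem listVal_blockCost_le {c : ℕ} (hc : 1 ≤ c) (l : List ℕ) (hl : ∀ x ∈ l, 0 < x) :
    12 * (c * (listVal c l / 8)) +
      2 * (c * blockCost (listVal c l % 8) ((listVal c l + l.sum + l.length) % 2)) +
        l.length ≤ l.sum := by
  induction l with
  | nil => simp [blockCost]
  | cons h l ih =>
    have ih := ih fun x hx => hl x (List.mem_cons_of_mem _ hx)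
    have hp := pileVal_blockCost_le hc (hl h List.mem_cons_self)
    rw [listVal_cons, List.sum_cons, List.length_cons]
    generalize pileVal c h = g at *
    generalize listVal c l = v at *
    generalize l.sum = S at *
    generalize l.length = p at *
    have e1 : (g ^^^ v) / 8 = g / 8 ^^^ v / 8 := Nat.xor_div_two_pow (n := 3)
    have e2 : (g ^^^ v) % 8 = g % 8 ^^^ v % 8 := Nat.xor_mod_two_pow (n := 3)
    have e3 : ((g ^^^ v) + (h + S) + (p + 1)) % 2 = ((g + h + 1) % 2 + (v + S + p) % 2) % 2 := by
      have := Nat.xor_mod_two_eq (m := g) (n := v)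
      omega
    rw [e1, e2, e3]
    have i1 := Nat.mul_le_mul_left c (xor_le_add_self (g / 8) (v / 8))
    have i2 := Nat.mul_le_mul_left c (blockCost_xor_le (g % 8) (by omega) (v % 8) (by omega)
      ((g + h + 1) % 2) (by omega) ((v + S + p) % 2) (by omega))
    rw [mul_add] at i1 i2
    omega

theorem listVal_ne_of_length {c : ℕ} (hc : 1 ≤ c) (l : List ℕ) (hl : ∀ x ∈ l, 0 < x)
    (hlen : l.length = 2 * c + 1) : listVal c l ≠ pileVal c l.sum := by
  intro he
  have key := listVal_blockCost_le hc l hl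
  rw [he, hlen] at key
  obtain ⟨k, m, h0, h1, hs⟩ := exists_period_decomp hc (show 1 ≤ l.sum by omega)
  rw [hs, pileVal_add k h0 h1] at key
  have hlt := periodVal_lt c m
  have e1 : (8 * k + periodVal c m) / 8 = k := by omega
  have e2 : (8 * k + periodVal c m) % 8 = periodVal c m := by omega
  have e3 : (8 * k + periodVal c m + (12 * (c * k) + m) + (2 * c + 1)) % 2
      = (periodVal c m + m + 1) % 2 := by
    omega
  rw [e1, e2, e3] at key
  have key2 : 2 * (c * blockCost (periodVal c m) ((periodVal c m + m + 1) % 2)) +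
      2 * c + 1 ≤ m := by
    omega
  clear key
  have aux : ∀ b x, x = b → ¬ 2 * (c * b) + 2 * c + 1 ≤ m → ¬ 2 * (c * x) + 2 * c + 1 ≤ m := by
    rintro b x rfl h; exact h
  revert key2
  unfold periodVal blockCost
  split_ifs <;> first
    | exact aux 0 _ (by omega) (by omega)
    | exact aux 1 _ (by omega) (by omega)
    | exact aux 2 _ (by omega) (by omega)
    | exact aux 3 _ (by omega) (by omega)
    | exact aux 4 _ (by omega) (by omega)
    | exact aux 5 _ (by omega) (by omega)

theorem periodVal_cases (c m : ℕ) :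
    (m ≤ 2 * c ∧ periodVal c m = (m + 1) % 2) ∨
    (2 * c < m ∧ m ≤ 4 * c ∧ periodVal c m = 2 + (m + 1) % 2) ∨
    (4 * c + 1 ≤ m ∧ m ≤ 4 * c + 1 ∧ periodVal c m = 1) ∨
    (4 * c + 1 < m ∧ m ≤ 6 * c ∧ periodVal c m = 4 + m % 2) ∨
    (6 * c < m ∧ m ≤ 8 * c ∧ periodVal c m = 2 + m % 2) ∨
    (8 * c < m ∧ m ≤ 10 * c ∧ periodVal c m = 4 + (m + 1) % 2) ∨
    (10 * c < m ∧ periodVal c m = 6 + (m + 1) % 2) := by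
  unfold periodVal; split_ifs <;> grind

theorem periodVal_xor_ne {c a b : ℕ} (ha : 1 ≤ a) (hb : 1 ≤ b)
    (hab : a + b ≤ 12 * c) : periodVal c a ^^^ periodVal c b ≠ periodVal c (a + b) := by
  have h3 := periodVal_cases c (a + b)
  obtain ⟨hp, hp'⟩ | ⟨hp, hp'⟩ : (a % 2 = 0 ∧ (a + 1) % 2 = 1) ∨ (a % 2 = 1 ∧ (a + 1) % 2 = 0) := by
    omega
  all_goals
    obtain ⟨hq, hq'⟩ | ⟨hq, hq'⟩ :
        (b % 2 = 0 ∧ (b + 1) % 2 = 1) ∨ (b % 2 = 1 ∧ (b + 1) % 2 = 0) := by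
      omega
  all_goals
    rcases periodVal_cases c a with h | h | h | h | h | h | h <;>
    rcases periodVal_cases c b with h' | h' | h' | h' | h' | h' | h' <;>
    simp only [h, h', hp, hp', hq, hq', Nat.reduceXor, Nat.reduceAdd, Nat.xor_zero, Nat.zero_xor] <;>
      omega

/-- `v` is the closed-form nim-value of a legal move from the pile `n`. -/
def IsOptionVal (c n v : ℕ) : Prop :=
  ∃ d ∈ ({1, 2 * c} : Finset ℕ), ∃ l : List ℕ, l.length = d + 1 ∧ (∀ x ∈ l, 0 < x) ∧
    l.sum = n ∧ listVal c l = v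

theorem not_isOptionVal_pileVal {c n : ℕ} (hc : 2 ≤ c) : ¬ IsOptionVal c n (pileVal c n) := by
  rintro ⟨d, hd, l, hlen, hl, rfl, hv⟩
  rcases Finset.mem_insert.1 hd with rfl | hd
  · obtain ⟨a, b, rfl⟩ := List.length_eq_two.1 hlen
    have ha : 0 < a := hl a (by simp)
    have hb : 0 < b := hl b (by simp)
    simp only [listVal_cons, listVal_nil, Nat.xor_zero, List.sum_cons, List.sum_nil,
      add_zero] at hv
    obtain ⟨k₁, m₁, h₁, h₁', rfl⟩ := exists_period_decomp (c := c) (by omega) ha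
    obtain ⟨k₂, m₂, h₂, h₂', rfl⟩ := exists_period_decomp (c := c) (by omega) hb
    obtain ⟨k, m, h, h', e⟩ := exists_period_decomp (c := c) (n := 12 * (c * k₁) + m₁ +
      (12 * (c * k₂) + m₂)) (by omega) (by omega)
    rw [e, pileVal_add _ h₁ h₁', pileVal_add _ h₂ h₂', pileVal_add _ h h',
      eight_mul_add_xor _ _ _ _ (periodVal_lt _ _) (periodVal_lt _ _)] at hv
    have hx := Nat.xor_lt_two_pow (n := 3) (periodVal_lt c m₁) (periodVal_lt c m₂)
    have hm := periodVal_lt c m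
    have hk : k₁ ^^^ k₂ = k := by omega
    have hle := xor_le_add_self k₁ k₂
    have hpar := Nat.xor_mod_two_eq (m := k₁) (n := k₂)
    obtain ⟨i, hi⟩ : ∃ i, k₁ + k₂ = k + 2 * i := ⟨(k₁ + k₂ - k) / 2, by omega⟩
    have hck : c * k₁ + c * k₂ = c * k + 2 * (c * i) := by
      rw [← mul_add, hi]; ring
    obtain rfl : i = 0 := by
      by_contra h0
      have := Nat.le_mul_of_pos_right c (Nat.pos_of_ne_zero h0)
      omega
    obtain rfl : m = m₁ + m₂ := by omega
    exact periodVal_xor_ne h₁ h₂ h' (by omega)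
  · obtain rfl := Finset.mem_singleton.1 hd
    exact listVal_ne_of_length (by omega) l hl hlen hv

theorem isOptionVal_pair {c a b : ℕ} (ha : 0 < a) (hb : 0 < b) :
    IsOptionVal c (a + b) (pileVal c a ^^^ pileVal c b) :=
  ⟨1, by simp, [a, b], rfl, by simp [ha, hb], by simp, by simp⟩

theorem isOptionVal_of_eq_add {c n h y j : ℕ} (hc : 2 ≤ c) (hh : 0 < h) (hy : 0 < y)
    (hj : 0 < j) (hn : n = h + 2 * y + j + (2 * c - 3)) :
    IsOptionVal c n (pileVal c h ^^^ pileVal c j) := by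
  refine ⟨2 * c, by simp, h :: y :: y :: j :: List.replicate (2 * c - 3) 1, ?_, ?_, ?_, ?_⟩
  · simp; omega
  · intro x hx
    simp only [List.mem_cons, List.mem_replicate] at hx
    omega
  · simp; omega
  · simp [listVal_replicate_one (show 1 ≤ c by omega)]

theorem isOptionVal_period {c n m : ℕ} (k : ℕ) (hc : 2 ≤ c) (h0 : 1 ≤ m) (h1 : m ≤ 12 * c)
    (hn : 12 * (c * k) + m + 2 * c ≤ n) (hp : n % 2 = m % 2) :
    IsOptionVal c n (8 * k + periodVal c m) := by
  have := isOptionVal_of_eq_add (n := n) (h := 12 * (c * k) + m)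
    (y := (n - (12 * (c * k) + m + 2 * c) + 2) / 2) (j := 1) hc (by omega) (by omega) (by omega)
    (by omega)
  rwa [pileVal_one (by omega), pileVal_add k h0 h1, Nat.xor_zero] at this

theorem isOptionVal_period_xor {c n m : ℕ} (k j : ℕ) (hc : 2 ≤ c) (h0 : 1 ≤ m) (h1 : m ≤ 12 * c)
    (hj : 1 ≤ j) (hj' : j ≤ 12 * c)
    (hn : 12 * (c * k) + m + j + 2 * c ≤ n + 1) (hp : n % 2 = (m + j + 1) % 2) :
    IsOptionVal c n (8 * k + (periodVal c m ^^^ periodVal c j)) := by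
  have := isOptionVal_of_eq_add (n := n) (h := 12 * (c * k) + m)
    (y := (n + 1 - (12 * (c * k) + m + j + 2 * c) + 2) / 2) (j := j) hc (by omega) (by omega)
    (by omega) (by omega)
  have e := eight_mul_add_xor k 0 _ _ (periodVal_lt c m) (periodVal_lt c j)
  simp only [Nat.mul_zero, zero_add, Nat.xor_zero] at e
  rwa [pileVal_add k h0 h1, pileVal_of_le hj hj', e] at this

theorem isOptionVal_split {c m : ℕ} (k a b : ℕ) (ha : 1 ≤ a) (hb : 1 ≤ b)
    (hab : a + b = m) (hm : m ≤ 12 * c) :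
    IsOptionVal c (12 * (c * k) + m) (8 * k + (periodVal c a ^^^ periodVal c b)) := by
  have := isOptionVal_pair (c := c) (a := 12 * (c * k) + a) (b := b) (by omega) (by omega)
  have e := eight_mul_add_xor k 0 _ _ (periodVal_lt c a) (periodVal_lt c b)
  simp only [Nat.mul_zero, zero_add, Nat.xor_zero] at e
  rwa [pileVal_add k ha (by omega), pileVal_of_le hb (by omega), e, add_assoc, hab] at this

theorem periodVal_of_block_zero {c m v : ℕ} (h : m ≤ 2 * c) (hv : (m + 1) % 2 = v) :
    periodVal c m = v := by
  rw [periodVal, if_pos h, hv]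

theorem periodVal_of_block_one {c m v : ℕ} (h : 2 * c < m ∧ m ≤ 4 * c) (hv : 2 + (m + 1) % 2 = v) :
    periodVal c m = v := by
  subst hv; unfold periodVal; split_ifs <;> first | rfl | omega

theorem periodVal_of_block_two {c m v : ℕ} (h : 4 * c + 1 < m ∧ m ≤ 6 * c) (hv : 4 + m % 2 = v) :
    periodVal c m = v := by
  subst hv; unfold periodVal; split_ifs <;> first | rfl | omega

theorem periodVal_of_block_three {c m v : ℕ} (h : 6 * c < m ∧ m ≤ 8 * c) (hv : 2 + m % 2 = v) :
    periodVal c m = v := by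
  subst hv; unfold periodVal; split_ifs <;> first | rfl | omega

theorem periodVal_of_block_four {c m v : ℕ} (h : 8 * c < m ∧ m ≤ 10 * c)
    (hv : 4 + (m + 1) % 2 = v) :
    periodVal c m = v := by
  subst hv; unfold periodVal; split_ifs <;> first | rfl | omega

theorem periodVal_of_block_five {c m v : ℕ} (hc : 2 ≤ c) (h : 10 * c < m)
    (hv : 6 + (m + 1) % 2 = v) :
    periodVal c m = v := by
  subst hv; unfold periodVal; split_ifs <;> first | rfl | omega

theorem periodVal_two_mul_add_one {c : ℕ} (hc : 2 ≤ c) : periodVal c (2 * c + 1) = 2 := by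
  unfold periodVal; split_ifs <;> omega

theorem periodVal_four_mul_add_one {c : ℕ} (hc : 2 ≤ c) : periodVal c (4 * c + 1) = 1 := by
  unfold periodVal; split_ifs <;> omega

theorem periodVal_four_mul_add_two {c : ℕ} (hc : 2 ≤ c) : periodVal c (4 * c + 2) = 4 := by
  unfold periodVal; split_ifs <;> omega

theorem periodVal_four_mul_add_three {c : ℕ} (hc : 2 ≤ c) : periodVal c (4 * c + 3) = 5 := by
  unfold periodVal; split_ifs <;> omega

theorem periodVal_one {c : ℕ} (hc : 2 ≤ c) : periodVal c 1 = 0 := by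
  unfold periodVal; split_ifs <;> omega

theorem periodVal_two {c : ℕ} (hc : 2 ≤ c) : periodVal c 2 = 1 := by
  unfold periodVal; split_ifs <;> omega

theorem isOptionVal_of_lt_period {c k n w : ℕ} (hc : 2 ≤ c) (hw : w < 8)
    (hn : 12 * (c * k) + 12 * c < n) : IsOptionVal c n (8 * k + w) := by
  have direct : ∀ m, 1 ≤ m → m ≤ 12 * c → 12 * (c * k) + m + 2 * c ≤ n → n % 2 = m % 2 →
      periodVal c m = w → IsOptionVal c n (8 * k + w) := by
    rintro m h0 h1 h2 h3 rfl
    exact isOptionVal_period k hc h0 h1 h2 h3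
  have extra : ∀ m j, 1 ≤ m → m ≤ 12 * c → 1 ≤ j → j ≤ 12 * c →
      12 * (c * k) + m + j + 2 * c ≤ n + 1 → n % 2 = (m + j + 1) % 2 →
      periodVal c m ^^^ periodVal c j = w → IsOptionVal c n (8 * k + w) := by
    rintro m j h0 h1 h2 h3 h4 h5 rfl
    exact isOptionVal_period_xor k j hc h0 h1 h2 h3 h4 h5
  rcases Nat.mod_two_eq_zero_or_one n with hp | hp <;> interval_cases w
  · exact extra (4 * c + 1) 2 (by omega) (by omega) (by omega) (by omega) (by omega) (by omega)
      (by rw [periodVal_four_mul_add_one hc, periodVal_two hc]; rfl)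
  · exact direct 2 (by omega) (by omega) (by omega) (by omega)
      (periodVal_of_block_zero (by omega) (by omega))
  · exact direct (6 * c + 2) (by omega) (by omega) (by omega) (by omega)
      (periodVal_of_block_three (by omega) (by omega))
  · exact direct (2 * c + 2) (by omega) (by omega) (by omega) (by omega)
      (periodVal_of_block_one (by omega) (by omega))
  · exact direct (4 * c + 2) (by omega) (by omega) (by omega) (by omega)
      (periodVal_of_block_two (by omega) (by omega))
  · exact direct (8 * c + 2) (by omega) (by omega) (by omega) (by omega)
      (periodVal_of_block_four (by omega) (by omega))
  · exact extra (4 * c + 2) (2 * c + 1) (by omega) (by omega) (by omega) (by omega) (by omega)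
      (by omega) (by rw [periodVal_four_mul_add_two hc, periodVal_two_mul_add_one hc]; rfl)
  · exact direct (10 * c + 2) (by omega) (by omega) (by omega) (by omega)
      (periodVal_of_block_five hc (by omega) (by omega))
  · exact direct 1 (by omega) (by omega) (by omega) (by omega)
      (periodVal_of_block_zero (by omega) (by omega))
  · exact direct (4 * c + 1) (by omega) (by omega) (by omega) (by omega)
      (periodVal_four_mul_add_one hc)
  · exact direct (2 * c + 1) (by omega) (by omega) (by omega) (by omega)
      (periodVal_of_block_one (by omega) (by omega))
  · exact direct (6 * c + 1) (by omega) (by omega) (by omega) (by omega)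
      (periodVal_of_block_three (by omega) (by omega))
  · exact direct (8 * c + 1) (by omega) (by omega) (by omega) (by omega)
      (periodVal_of_block_four (by omega) (by omega))
  · exact direct (4 * c + 3) (by omega) (by omega) (by omega) (by omega)
      (periodVal_of_block_two (by omega) (by omega))
  · exact direct (10 * c + 1) (by omega) (by omega) (by omega) (by omega)
      (periodVal_of_block_five hc (by omega) (by omega))
  · exact extra (4 * c + 3) (2 * c + 1) (by omega) (by omega) (by omega) (by omega) (by omega)
      (by omega) (by rw [periodVal_four_mul_add_three hc, periodVal_two_mul_add_one hc]; rfl)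

theorem isOptionVal_of_lt_periodVal {c k m w : ℕ} (hc : 2 ≤ c) (h0 : 1 ≤ m) (h1 : m ≤ 12 * c)
    (hw : w < periodVal c m) : IsOptionVal c (12 * (c * k) + m) (8 * k + w) := by
  have hlt := periodVal_lt c m
  have hm := periodVal_cases c m
  have direct : ∀ i, 1 ≤ i → i + 2 * c ≤ m → m % 2 = i % 2 →
      periodVal c i = w → IsOptionVal c (12 * (c * k) + m) (8 * k + w) := by
    rintro i h2 h3 h4 rfl
    exact isOptionVal_period k hc h2 (by omega) (by omega) (by omega)
  have split : ∀ a b u v, 1 ≤ a → 1 ≤ b → a + b = m → periodVal c a = u → periodVal c b = v →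
      u ^^^ v = w → IsOptionVal c (12 * (c * k) + m) (8 * k + w) := by
    rintro a b _ _ h2 h3 h4 rfl rfl rfl
    exact isOptionVal_split k a b h2 h3 h4 h1
  have pred : ∀ v, 1 < m → periodVal c (m - 1) = v → v = w →
      IsOptionVal c (12 * (c * k) + m) (8 * k + w) := by
    rintro v h2 h3 rfl
    exact split (m - 1) 1 v 0 (by omega) le_rfl (by omega) h3 (periodVal_one hc) (Nat.xor_zero v)
  rcases Nat.mod_two_eq_zero_or_one m with hp | hp
  · obtain rfl | rfl | rfl | rfl | rfl | rfl | rfl : w = 0 ∨ w = 1 ∨ w = 2 ∨ w = 3 ∨ w = 4 ∨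
        w = 5 ∨ w = 6 := by omega
    · have hb : 1 ≤ m ∧ m % 2 = 0 := by omega
      clear hm hw hlt
      exact split (m / 2) (m / 2) _ _ (by omega) (by omega) (by omega) rfl rfl (Nat.xor_self _)
    · have hb : 2 * c + 2 ≤ m := by omega
      clear hm hw hlt
      exact direct 2 (by omega) (by omega) (by omega)
        (periodVal_of_block_zero (by omega) (by omega))
    · have hb : 2 * c + 2 ≤ m ∧ ¬ (6 * c < m ∧ m ≤ 8 * c) := by omega
      clear hm hw hlt
      by_cases h8 : 8 * c < m
      · exact direct (6 * c + 2) (by omega) (by omega) (by omega)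
          (periodVal_of_block_three (by omega) (by omega))
      by_cases h4 : m ≤ 4 * c
      · exact pred 2 (by omega) (periodVal_of_block_one (by omega) (by omega)) rfl
      rcases Nat.mod_two_eq_zero_or_one (m / 2 + c) with hq | hq
      · exact split (m / 2 + c) (m / 2 - c) 3 1 (by omega) (by omega) (by omega)
          (periodVal_of_block_one (by omega) (by omega))
          (periodVal_of_block_zero (by omega) (by omega)) rfl
      · exact split (m / 2 + c) (m / 2 - c) 2 0 (by omega) (by omega) (by omega)
          (periodVal_of_block_one (by omega) (by omega))
          (periodVal_of_block_zero (by omega) (by omega)) rfl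
    · have hb : 4 * c + 2 ≤ m := by omega
      clear hm hw hlt
      exact direct (2 * c + 2) (by omega) (by omega) (by omega)
        (periodVal_of_block_one (by omega) (by omega))
    · have hb : 8 * c + 2 ≤ m := by omega
      clear hm hw hlt
      exact direct (4 * c + 2) (by omega) (by omega) (by omega)
        (periodVal_of_block_two (by omega) (by omega))
    · have hb : 10 * c + 2 ≤ m := by omega
      clear hm hw hlt
      exact direct (8 * c + 2) (by omega) (by omega) (by omega)
        (periodVal_of_block_four (by omega) (by omega))
    · have hb : 10 * c + 2 ≤ m := by omega
      clear hm hw hlt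
      exact pred 6 (by omega) (periodVal_of_block_five hc (by omega) (by omega)) rfl
  · obtain rfl | rfl | rfl | rfl | rfl | rfl | rfl : w = 0 ∨ w = 1 ∨ w = 2 ∨ w = 3 ∨ w = 4 ∨
        w = 5 ∨ w = 6 := by omega
    · have hb : 2 * c + 1 ≤ m := by omega
      clear hm hw hlt
      exact direct 1 (by omega) (by omega) (by omega)
        (periodVal_of_block_zero (by omega) (by omega))
    · have hb : 2 * c + 1 ≤ m ∧ m ≠ 4 * c + 1 := by omega
      clear hm hw hlt
      by_cases h6 : 6 * c < m
      · exact direct (4 * c + 1) (by omega) (by omega) (by omega) (periodVal_four_mul_add_one hc)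
      by_cases h4 : m ≤ 4 * c
      · exact split (2 * c) (m - 2 * c) 1 0 (by omega) (by omega) (by omega)
          (periodVal_of_block_zero (by omega) (by omega))
          (periodVal_of_block_zero (by omega) (by omega)) rfl
      · exact split (2 * c + 1) (m - (2 * c + 1)) 2 3 (by omega) (by omega) (by omega)
          (periodVal_of_block_one (by omega) (by omega))
          (periodVal_of_block_one (by omega) (by omega)) rfl
    · have hb : 4 * c + 3 ≤ m := by omega
      clear hm hw hlt
      exact direct (2 * c + 1) (by omega) (by omega) (by omega)
        (periodVal_of_block_one (by omega) (by omega))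
    · have hb : 4 * c + 3 ≤ m ∧ ¬ (6 * c < m ∧ m ≤ 8 * c) := by omega
      clear hm hw hlt
      by_cases h6 : 6 * c < m
      · exact direct (6 * c + 1) (by omega) (by omega) (by omega)
          (periodVal_of_block_three (by omega) (by omega))
      · exact split (4 * c) (m - 4 * c) 3 0 (by omega) (by omega) (by omega)
          (periodVal_of_block_one (by omega) (by omega))
          (periodVal_of_block_zero (by omega) (by omega)) rfl
    · have hb : 4 * c + 3 ≤ m ∧ (m ≤ 6 * c ∨ 10 * c < m) := by omega
      clear hm hw hlt
      by_cases h6 : 6 * c < m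
      · exact direct (8 * c + 1) (by omega) (by omega) (by omega)
          (periodVal_of_block_four (by omega) (by omega))
      · exact pred 4 (by omega) (periodVal_of_block_two (by omega) (by omega)) rfl
    · have hb : 10 * c + 1 ≤ m := by omega
      clear hm hw hlt
      exact direct (4 * c + 3) (by omega) (by omega) (by omega)
        (periodVal_of_block_two (by omega) (by omega))
    · omega

theorem isOptionVal_of_lt_pileVal {c n v : ℕ} (hc : 2 ≤ c) (hn : 1 ≤ n) (hv : v < pileVal c n) :
    IsOptionVal c n v := by
  obtain ⟨k, m, h0, h1, rfl⟩ := exists_period_decomp (c := c) (by omega) hn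
  rw [pileVal_add k h0 h1] at hv
  have hlt := periodVal_lt c m
  rw [← Nat.div_add_mod v 8]
  by_cases hk : v / 8 = k
  · rw [hk]
    exact isOptionVal_of_lt_periodVal hc h0 h1 (by omega)
  · have := Nat.mul_le_mul_left c (show v / 8 + 1 ≤ k by omega)
    rw [mul_add, mul_one] at this
    exact isOptionVal_of_lt_period hc (by omega) (by omega)

theorem mex_eq_s5 {S : Set ℕ} {a : ℕ} (ha : a ∉ S) (h : ∀ v < a, v ∈ S) : mex S = a :=
  IsLeast.csInf_eq ⟨ha, fun v hv => not_lt.1 fun hlt => hv (h v hlt)⟩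

theorem add_length_le_sum_add_one {l : List ℕ} (hl : ∀ x ∈ l, 0 < x) {x : ℕ} (hx : x ∈ l) :
    x + l.length ≤ l.sum + 1 := by
  induction l with
  | nil => simp at hx
  | cons a l ih =>
    have ha := hl a List.mem_cons_self
    have hl' : ∀ y ∈ l, 0 < y := fun y hy => hl y (List.mem_cons_of_mem _ hy)
    simp only [List.sum_cons, List.length_cons]
    rcases List.mem_cons.1 hx with rfl | hx
    · have := List.length_le_sum_of_one_le l hl'
      omega
    · have := ih hl' hx
      omega

theorem cutGAux_eq_pileVal {c : ℕ} (hc : 2 ≤ c) (fuel n : ℕ) (hn : 1 ≤ n) (hf : n ≤ fuel) :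
    cutGAux {1, 2 * c} fuel n = pileVal c n := by
  induction fuel generalizing n with
  | zero => omega
  | succ fuel ih =>
    have hmap : ∀ d ∈ ({1, 2 * c} : Finset ℕ), ∀ l : List ℕ, l.length = d + 1 →
        (∀ x ∈ l, 0 < x) → l.sum = n →
        (l.map (cutGAux {1, 2 * c} fuel)).foldr (· ^^^ ·) 0 = listVal c l := by
      intro d hd l hlen hl hsum
      rw [listVal, List.map_congr_left]
      intro x hx
      have := add_length_le_sum_add_one hl hx
      have hd : d = 1 ∨ d = 2 * c := by simpa using hd
      exact ih x (hl x hx) (by omega)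
    refine mex_eq_s5 ?_ fun v hv => ?_
    · rintro ⟨d, hd, l, hlen, hl, hsum, hv⟩
      exact not_isOptionVal_pileVal hc
        ⟨d, hd, l, hlen, hl, hsum, (hmap d hd l hlen hl hsum).symm.trans hv⟩
    · obtain ⟨d, hd, l, hlen, hl, hsum, hv⟩ := isOptionVal_of_lt_pileVal hc hn hv
      exact ⟨d, hd, l, hlen, hl, hsum, (hmap d hd l hlen hl hsum).trans hv⟩

theorem nimVal_eq_listVal {c : ℕ} (hc : 2 ≤ c) {l : List ℕ} (hl : ∀ x ∈ l, 0 < x) :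
    nimVal {1, 2 * c} l = listVal c l := by
  rw [nimVal, listVal, List.map_congr_left]
  exact fun x hx => cutGAux_eq_pileVal hc x x (hl x hx) le_rfl

/-- The offset, within its period, of the greatest innumber below the offset `m`. -/
def floorPos (c m : ℕ) : ℕ :=
  if m ≤ 2 * c then 1
  else if m ≤ 4 * c then 2 * c + 1
  else if m = 4 * c + 1 then 4 * c + 1
  else if m ≤ 6 * c then 4 * c + 2
  else if m ≤ 8 * c then 6 * c + 1
  else if m ≤ 10 * c then 8 * c + 1
  else 10 * c + 1

/-- The offset, within its period, of the least outnumber above the offset `m`. -/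
def ceilPos (c m : ℕ) : ℕ :=
  if m ≤ 2 * c then 2 * c
  else if m ≤ 4 * c then 4 * c
  else if m = 4 * c + 1 then 4 * c + 1
  else if m ≤ 6 * c then 6 * c
  else if m ≤ 8 * c then 8 * c
  else if m ≤ 10 * c then 10 * c
  else 12 * c

theorem period_add_mod_two_mul (c k m : ℕ) : (12 * (c * k) + m) % (2 * c) = m % (2 * c) := by
  rw [show 12 * (c * k) + m = 2 * c * (6 * k) + m by ring, Nat.mul_add_mod]

theorem period_add_mod_period (c k m : ℕ) : (12 * (c * k) + m) % (12 * c) = m % (12 * c) := by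
  rw [← mul_assoc, Nat.mul_add_mod]

theorem innumber_period_add_iff {c m : ℕ} (k : ℕ) (hc : 2 ≤ c) (h0 : 1 ≤ m) (h1 : m ≤ 12 * c) :
    Innumber c (12 * (c * k) + m) ↔ m = 1 ∨ m = 2 * c + 1 ∨ m = 4 * c + 1 ∨ m = 4 * c + 2 ∨
      m = 6 * c + 1 ∨ m = 8 * c + 1 ∨ m = 10 * c + 1 := by
  rw [Innumber, period_add_mod_two_mul, period_add_mod_period]
  have e1 : m % (12 * c) = 4 * c + 2 ↔ m = 4 * c + 2 := by
    rcases h1.lt_or_eq with h | h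
    · rw [Nat.mod_eq_of_lt h]
    · rw [h, Nat.mod_self]; omega
  have e2 := Nat.div_add_mod m (2 * c)
  have e3 := Nat.mod_lt m (show 2 * c > 0 by omega)
  have e4 : m / (2 * c) ≤ 6 := Nat.div_le_of_le_mul (by omega)
  rw [e1]
  generalize m % (2 * c) = r at *
  generalize m / (2 * c) = q at *
  interval_cases q <;> omega

theorem outnumber_period_add_iff {c m : ℕ} (k : ℕ) (hc : 2 ≤ c) (h0 : 1 ≤ m) (h1 : m ≤ 12 * c) :
    Outnumber c (12 * (c * k) + m) ↔ m = 2 * c ∨ m = 4 * c ∨ m = 4 * c + 1 ∨ m = 6 * c ∨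
      m = 8 * c ∨ m = 10 * c ∨ m = 12 * c := by
  rw [Outnumber, period_add_mod_two_mul, period_add_mod_period]
  have e1 : m % (12 * c) = 4 * c + 1 ↔ m = 4 * c + 1 := by
    rcases h1.lt_or_eq with h | h
    · rw [Nat.mod_eq_of_lt h]
    · rw [h, Nat.mod_self]; omega
  have e2 := Nat.div_add_mod m (2 * c)
  have e3 := Nat.mod_lt m (show 2 * c > 0 by omega)
  have e4 : m / (2 * c) ≤ 6 := Nat.div_le_of_le_mul (by omega)
  rw [e1]
  generalize m % (2 * c) = r at *
  generalize m / (2 * c) = q at *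
  interval_cases q <;> omega

theorem floorPos_mem {c m : ℕ} (h0 : 1 ≤ m) : 1 ≤ floorPos c m ∧ floorPos c m ≤ m := by
  unfold floorPos; split_ifs <;> omega

theorem ceilPos_mem {c m : ℕ} (h1 : m ≤ 12 * c) : m ≤ ceilPos c m ∧ ceilPos c m ≤ 12 * c := by
  unfold ceilPos; split_ifs <;> omega

theorem floorIn_period_add {c m : ℕ} (k : ℕ) (hc : 2 ≤ c) (h0 : 1 ≤ m) (h1 : m ≤ 12 * c) :
    floorIn c (12 * (c * k) + m) = 12 * (c * k) + floorPos c m := by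
  have hf := floorPos_mem (c := c) h0
  refine IsGreatest.csSup_eq ⟨⟨?_, by omega⟩, ?_⟩
  · rw [innumber_period_add_iff k hc hf.1 (by omega)]
    unfold floorPos; split_ifs <;> simp
  · rintro x ⟨hx, hle⟩
    obtain ⟨k', m', h0', h1', rfl⟩ := exists_period_decomp (c := c) (by omega) hx.1
    rw [innumber_period_add_iff k' hc h0' h1'] at hx
    rcases lt_trichotomy k' k with hk | rfl | hk
    · have := Nat.mul_le_mul_left c (Nat.succ_le_of_lt hk)
      rw [Nat.succ_eq_add_one, mul_add, mul_one] at this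
      omega
    · have : m' ≤ floorPos c m := by
        have : m' ≤ m := by omega
        unfold floorPos; split_ifs <;> omega
      omega
    · have := Nat.mul_le_mul_left c (Nat.succ_le_of_lt hk)
      rw [Nat.succ_eq_add_one, mul_add, mul_one] at this
      omega

theorem ceilOut_period_add {c m : ℕ} (k : ℕ) (hc : 2 ≤ c) (h0 : 1 ≤ m) (h1 : m ≤ 12 * c) :
    ceilOut c (12 * (c * k) + m) = 12 * (c * k) + ceilPos c m := by
  have hf := ceilPos_mem h1
  refine IsLeast.csInf_eq ⟨⟨?_, by omega⟩, ?_⟩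
  · rw [outnumber_period_add_iff k hc (by omega) hf.2]
    unfold ceilPos; split_ifs <;> simp
  · rintro x ⟨hx, hle⟩
    obtain ⟨k', m', h0', h1', rfl⟩ := exists_period_decomp (c := c) (by omega) hx.1
    rw [outnumber_period_add_iff k' hc h0' h1'] at hx
    rcases lt_trichotomy k' k with hk | rfl | hk
    · have := Nat.mul_le_mul_left c (Nat.succ_le_of_lt hk)
      rw [Nat.succ_eq_add_one, mul_add, mul_one] at this
      omega
    · have : ceilPos c m ≤ m' := by
        have : m ≤ m' := by omega
        unfold ceilPos; split_ifs <;> omega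
      omega
    · have := Nat.mul_le_mul_left c (Nat.succ_le_of_lt hk)
      rw [Nat.succ_eq_add_one, mul_add, mul_one] at this
      omega

theorem floorIn_mem {c h : ℕ} (hc : 2 ≤ c) (hh : 1 ≤ h) : 1 ≤ floorIn c h ∧ floorIn c h ≤ h := by
  obtain ⟨k, m, h0, h1, rfl⟩ := exists_period_decomp (c := c) (by omega) hh
  rw [floorIn_period_add k hc h0 h1]
  have := floorPos_mem (c := c) h0
  omega

theorem le_ceilOut {c h : ℕ} (hc : 2 ≤ c) (hh : 1 ≤ h) : h ≤ ceilOut c h := by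
  obtain ⟨k, m, h0, h1, rfl⟩ := exists_period_decomp (c := c) (by omega) hh
  rw [ceilOut_period_add k hc h0 h1]
  have := ceilPos_mem h1
  omega

theorem floorPos_ceilPos_cases (c m : ℕ) :
    (floorPos c m = 1 ∧ ceilPos c m = 2 * c) ∨
    (floorPos c m = 2 * c + 1 ∧ ceilPos c m = 4 * c) ∨
    (floorPos c m = 4 * c + 1 ∧ ceilPos c m = 4 * c + 1) ∨
    (floorPos c m = 4 * c + 2 ∧ ceilPos c m = 6 * c) ∨
    (floorPos c m = 6 * c + 1 ∧ ceilPos c m = 8 * c) ∨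
    (floorPos c m = 8 * c + 1 ∧ ceilPos c m = 10 * c) ∨
    (floorPos c m = 10 * c + 1 ∧ ceilPos c m = 12 * c) := by
  unfold floorPos ceilPos; split_ifs <;> simp

theorem floorIn_eq_of_mem {c h x : ℕ} (hc : 2 ≤ c) (hh : 1 ≤ h) (hx : floorIn c h ≤ x)
    (hx' : x ≤ ceilOut c h) : floorIn c x = floorIn c h := by
  obtain ⟨k, m, h0, h1, rfl⟩ := exists_period_decomp (c := c) (by omega) hh
  rw [floorIn_period_add k hc h0 h1] at hx ⊢
  rw [ceilOut_period_add k hc h0 h1] at hx'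
  obtain ⟨i, rfl⟩ := Nat.exists_eq_add_of_le (le_trans (Nat.le_add_right _ _) hx)
  have hf := floorPos_mem (c := c) h0
  have hg := ceilPos_mem h1
  rw [floorIn_period_add k hc (by omega) (by omega)]
  congr 1
  have hi : floorPos c m ≤ i := by omega
  have hi' : i ≤ ceilPos c m := by omega
  clear hx hx' hf hg
  rcases floorPos_ceilPos_cases c m with h | h | h | h | h | h | h <;>
    (rw [h.1] at hi ⊢; rw [h.2] at hi'; clear h; unfold floorPos; split_ifs <;> omega)

theorem pileVal_eq_floorIn_xor {c h : ℕ} (hc : 2 ≤ c) (hh : 1 ≤ h) :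
    pileVal c h = pileVal c (floorIn c h) ^^^ ((h + floorIn c h) % 2) := by
  obtain ⟨k, m, h0, h1, rfl⟩ := exists_period_decomp (c := c) (by omega) hh
  have hf := floorPos_mem (c := c) h0
  rw [floorIn_period_add k hc h0 h1, pileVal_add k h0 h1, pileVal_add k hf.1 (by omega),
    show (12 * (c * k) + m + (12 * (c * k) + floorPos c m)) % 2 = (m + floorPos c m) % 2 by omega]
  have e := eight_mul_add_xor k 0 _ ((m + floorPos c m) % 2) (periodVal_lt c (floorPos c m))
    (by omega)
  simp only [Nat.mul_zero, zero_add, Nat.xor_zero] at e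
  rw [e]
  congr 1
  clear e hf
  have key : ∀ f u v, floorPos c m = f → periodVal c f = u → periodVal c m = v →
      v = u ^^^ ((m + f) % 2) →
      periodVal c m = periodVal c (floorPos c m) ^^^ ((m + floorPos c m) % 2) := by
    rintro _ _ _ rfl rfl rfl h
    exact h
  have xor_bit : ∀ a < 4, ∀ b < 2, 2 * a + b = (2 * a) ^^^ b := by decide
  by_cases b0 : m ≤ 2 * c
  · refine key 1 0 _ (by rw [floorPos, if_pos b0]) (periodVal_one hc)
      (periodVal_of_block_zero b0 rfl) ?_
    rw [Nat.zero_xor]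
  by_cases b1 : m ≤ 4 * c
  · refine key (2 * c + 1) 2 _ (by rw [floorPos, if_neg b0, if_pos b1])
      (periodVal_two_mul_add_one hc) (periodVal_of_block_one (by omega) rfl) ?_
    rw [xor_bit 1 (by omega) _ (by omega)]; congr 1; omega
  by_cases b2 : m = 4 * c + 1
  · refine key (4 * c + 1) 1 1 (by rw [floorPos, if_neg b0, if_neg b1, if_pos b2])
      (periodVal_four_mul_add_one hc) (b2 ▸ periodVal_four_mul_add_one hc) ?_
    rw [show (m + (4 * c + 1)) % 2 = 0 by omega]; rfl
  by_cases b3 : m ≤ 6 * c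
  · refine key (4 * c + 2) 4 _ (by rw [floorPos, if_neg b0, if_neg b1, if_neg b2, if_pos b3])
      (periodVal_four_mul_add_two hc) (periodVal_of_block_two (by omega) rfl) ?_
    rw [xor_bit 2 (by omega) _ (by omega)]; congr 1; omega
  by_cases b4 : m ≤ 8 * c
  · refine key (6 * c + 1) 3 _
      (by rw [floorPos, if_neg b0, if_neg b1, if_neg b2, if_neg b3, if_pos b4])
      (periodVal_of_block_three (by omega) (by omega)) (periodVal_of_block_three (by omega) rfl) ?_
    rcases Nat.mod_two_eq_zero_or_one m with hp | hp
    · rw [hp, show (m + (6 * c + 1)) % 2 = 1 by omega]; rfl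
    · rw [hp, show (m + (6 * c + 1)) % 2 = 0 by omega]; rfl
  by_cases b5 : m ≤ 10 * c
  · refine key (8 * c + 1) 4 _
      (by rw [floorPos, if_neg b0, if_neg b1, if_neg b2, if_neg b3, if_neg b4, if_pos b5])
      (periodVal_of_block_four (by omega) (by omega)) (periodVal_of_block_four (by omega) rfl) ?_
    rw [xor_bit 2 (by omega) _ (by omega)]; congr 1; omega
  · refine key (10 * c + 1) 6 _
      (by rw [floorPos, if_neg b0, if_neg b1, if_neg b2, if_neg b3, if_neg b4, if_neg b5])
      (periodVal_of_block_five hc (by omega) (by omega))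
      (periodVal_of_block_five hc (by omega) rfl) ?_
    rw [xor_bit 3 (by omega) _ (by omega)]; congr 1; omega

theorem mod_two_xor_mod_two (a b : ℕ) : (a % 2) ^^^ (b % 2) = (a + b) % 2 := by
  rw [← Nat.xor_mod_two_eq]
  exact (Nat.xor_mod_two_pow (n := 1)).symm

theorem listVal_eq_map_floorIn_xor {c : ℕ} (hc : 2 ≤ c) (l : List ℕ) (hl : ∀ x ∈ l, 0 < x) :
    listVal c l =
      listVal c (l.map (floorIn c)) ^^^ ((l.sum + (l.map (floorIn c)).sum) % 2) := by
  induction l with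
  | nil => simp
  | cons h l ih =>
    have ih := ih fun x hx => hl x (List.mem_cons_of_mem _ hx)
    rw [List.map_cons, listVal_cons, listVal_cons, List.sum_cons, List.sum_cons, ih,
      pileVal_eq_floorIn_xor hc (hl h List.mem_cons_self), Nat.xor_assoc,
      Nat.xor_left_comm _ (listVal c _), mod_two_xor_mod_two, ← Nat.xor_assoc]
    congr 2
    omega

theorem exists_of_floorIn_mod {c h : ℕ} (hc : 2 ≤ c) (hh : 1 ≤ h)
    (hm : floorIn c h % (2 * c) = 2 % (2 * c)) :
    ∃ k m, 4 * c + 2 ≤ m ∧ m ≤ 6 * c ∧ h = 12 * (c * k) + m ∧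
      floorIn c h = 12 * (c * k) + (4 * c + 2) := by
  obtain ⟨k, m, h0, h1, rfl⟩ := exists_period_decomp (c := c) (by omega) hh
  rw [floorIn_period_add k hc h0 h1] at hm ⊢
  rw [period_add_mod_two_mul, Nat.mod_eq_of_lt (show 2 < 2 * c by omega)] at hm
  have hne : ∀ q, (2 * c * q + 1) % (2 * c) ≠ 2 := fun q => by
    rw [Nat.mul_add_mod, Nat.mod_eq_of_lt (by omega)]; omega
  have hfloor : floorPos c m = 4 * c + 2 ∧ 4 * c + 2 ≤ m ∧ m ≤ 6 * c := by
    unfold floorPos at hm ⊢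
    split_ifs at hm ⊢
    · exact absurd hm (by simpa using hne 0)
    · exact absurd hm (by simpa using hne 1)
    · exact absurd hm (by convert hne 2 using 3; ring)
    · omega
    · exact absurd hm (by convert hne 3 using 3; ring)
    · exact absurd hm (by convert hne 4 using 3; ring)
    · exact absurd hm (by convert hne 5 using 3; ring)
  exact ⟨k, m, hfloor.2.1, hfloor.2.2, rfl, by rw [hfloor.1]⟩

theorem floorPart_cases {c : ℕ} (hc : 2 ≤ c) (l : List ℕ) (hl : ∀ x ∈ l, 0 < x) :
    floorPart c l = l.map (floorIn c) ∨
      ∃ k₁ k₂ k₃,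
        l.map (floorIn c) = [12 * (c * k₁) + (4 * c + 2), 12 * (c * k₂) + (4 * c + 2),
          12 * (c * k₃) + (4 * c + 2)] ∧
        floorPart c l = [12 * (c * k₁) + (4 * c + 1), 12 * (c * k₂) + (4 * c + 1),
          12 * (c * k₃) + (4 * c + 2)] := by
  unfold floorPart
  split
  · rename_i h₁ h₂ h₃
    split_ifs with h
    · right
      obtain ⟨k₁, -, -, -, -, e₁⟩ := exists_of_floorIn_mod hc (hl h₁ (by simp)) h.1
      obtain ⟨k₂, -, -, -, -, e₂⟩ := exists_of_floorIn_mod hc (hl h₂ (by simp)) h.2.1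
      obtain ⟨k₃, -, -, -, -, e₃⟩ := exists_of_floorIn_mod hc (hl h₃ (by simp)) h.2.2
      refine ⟨k₁, k₂, k₃, ?_, ?_⟩ <;> simp [e₁, e₂, e₃]
    · left; rfl
  · left; rfl

theorem listVal_eq_floorPart_xor {c : ℕ} (hc : 2 ≤ c) (l : List ℕ) (hl : ∀ x ∈ l, 0 < x) :
    listVal c l = listVal c (floorPart c l) ^^^ ((l.sum + (floorPart c l).sum) % 2) := by
  rw [listVal_eq_map_floorIn_xor hc l hl]
  rcases floorPart_cases hc l hl with h | ⟨k₁, k₂, k₃, h, h'⟩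
  · rw [h]
  · rw [h, h']
    simp only [listVal_cons, listVal_nil, List.sum_cons, List.sum_nil]
    congr 1
    · rw [← Nat.xor_assoc, ← Nat.xor_assoc (pileVal c (12 * (c * k₁) + (4 * c + 1)))]
      congr 1
      rw [pileVal_add _ (by omega) (by omega), pileVal_add _ (by omega) (by omega),
        pileVal_add _ (by omega) (by omega), pileVal_add _ (by omega) (by omega),
        periodVal_four_mul_add_one hc, periodVal_four_mul_add_two hc,
        eight_mul_add_xor _ _ _ _ (by omega) (by omega),
        eight_mul_add_xor _ _ _ _ (by omega) (by omega)]
      rfl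
    · omega

theorem listVal_eq_of_map_floorIn_eq {c : ℕ} (hc : 2 ≤ c) {l l' : List ℕ} (hl : ∀ x ∈ l, 0 < x)
    (hl' : ∀ x ∈ l', 0 < x) (h : l'.map (floorIn c) = floorPart c l)
    (hs : l'.sum % 2 = l.sum % 2) : listVal c l' = listVal c l := by
  rw [listVal_eq_map_floorIn_xor hc l' hl', listVal_eq_floorPart_xor hc l hl, h]
  congr 1
  omega

theorem exists_map_floorIn_eq {c : ℕ} (hc : 2 ≤ c) (l : List ℕ) (hl : ∀ x ∈ l, 0 < x) (n : ℕ)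
    (hn : (l.map (floorIn c)).sum ≤ n) (hn' : n ≤ (l.map (ceilOut c)).sum) :
    ∃ l' : List ℕ, (∀ x ∈ l', 0 < x) ∧ l'.sum = n ∧ l'.map (floorIn c) = l.map (floorIn c) := by
  induction l generalizing n with
  | nil => exact ⟨[], by simp, (Nat.le_zero.1 hn').symm, rfl⟩
  | cons h l ih =>
    have hh : 1 ≤ h := hl h List.mem_cons_self
    have hl' : ∀ x ∈ l, 0 < x := fun x hx => hl x (List.mem_cons_of_mem _ hx)
    have hf := floorIn_mem hc hh
    have hg := le_ceilOut hc hh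
    simp only [List.map_cons, List.sum_cons] at hn hn'
    have hfg : (l.map (floorIn c)).sum ≤ (l.map (ceilOut c)).sum :=
      List.sum_le_sum fun x hx => (floorIn_mem hc (hl' x hx)).2.trans (le_ceilOut hc (hl' x hx))
    obtain ⟨x, hx, hx', hxn, hr, hr'⟩ : ∃ x, floorIn c h ≤ x ∧ x ≤ ceilOut c h ∧ x ≤ n ∧
        (l.map (floorIn c)).sum ≤ n - x ∧ n - x ≤ (l.map (ceilOut c)).sum :=
      ⟨min (ceilOut c h) (n - (l.map (floorIn c)).sum), by omega, by omega, by omega, by omega,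
        by omega⟩
    obtain ⟨l', hpos, hsum, hmap⟩ := ih hl' (n - x) hr hr'
    refine ⟨x :: l', ?_, ?_, ?_⟩
    · rintro y hy
      rcases List.mem_cons.1 hy with rfl | hy
      · omega
      · exact hpos y hy
    · rw [List.sum_cons, hsum]; omega
    · rw [List.map_cons, List.map_cons, hmap, floorIn_eq_of_mem hc hh hx hx']

theorem exists_map_floorIn_eq_floorPart {c : ℕ} (hc : 2 ≤ c) (l : List ℕ) (hl : ∀ x ∈ l, 0 < x)
    (n : ℕ) (hn : (floorPart c l).sum ≤ n) (hn' : n ≤ (ceilPart c l).sum)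
    (hp : n % 2 = l.sum % 2) :
    ∃ l' : List ℕ, l'.length = l.length ∧ (∀ x ∈ l', 0 < x) ∧ l'.sum = n ∧
      listVal c l' = listVal c l := by
  by_cases hle : (l.map (floorIn c)).sum ≤ n
  · obtain ⟨l', hpos, hsum, hmap⟩ := exists_map_floorIn_eq hc l hl n hle hn'
    refine ⟨l', by simpa using congrArg List.length hmap, hpos, hsum, ?_⟩
    rw [listVal_eq_map_floorIn_xor hc l' hpos, listVal_eq_map_floorIn_xor hc l hl, hmap]
    congr 1
    omega
  · rcases floorPart_cases hc l hl with h | ⟨k₁, k₂, k₃, h, h'⟩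
    · rw [h] at hn; omega
    · rw [h] at hle
      have hlen : l.length = 3 := by simpa using congrArg List.length h
      rw [h'] at hn
      simp only [List.sum_cons, List.sum_nil] at hn hle
      have e₁ : floorPos c (4 * c + 1) = 4 * c + 1 := by unfold floorPos; split_ifs <;> omega
      obtain ⟨i, hi, hi'⟩ : ∃ i, i ≤ 1 ∧ n = 12 * (c * k₁) + (4 * c + 1) +
          (12 * (c * k₂) + (4 * c + 1)) + (12 * (c * k₃) + (4 * c + 2 + i)) :=
        ⟨n - (12 * (c * k₁) + (4 * c + 1) + (12 * (c * k₂) + (4 * c + 1)) +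
          (12 * (c * k₃) + (4 * c + 2))), by omega, by omega⟩
      have e₂ : floorPos c (4 * c + 2 + i) = 4 * c + 2 := by unfold floorPos; split_ifs <;> omega
      have hpos : ∀ x ∈ [12 * (c * k₁) + (4 * c + 1), 12 * (c * k₂) + (4 * c + 1),
          12 * (c * k₃) + (4 * c + 2 + i)], 0 < x := by
        intro x hx
        simp only [List.mem_cons, List.not_mem_nil, or_false] at hx
        omega
      have hsum : [12 * (c * k₁) + (4 * c + 1), 12 * (c * k₂) + (4 * c + 1),
          12 * (c * k₃) + (4 * c + 2 + i)].sum = n := by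
        simp only [List.sum_cons, List.sum_nil]; omega
      refine ⟨_, hlen ▸ rfl, hpos, hsum, listVal_eq_of_map_floorIn_eq hc hl hpos ?_ ?_⟩
      · rw [h', List.map_cons, List.map_cons, List.map_cons, List.map_nil,
          floorIn_period_add _ hc (by omega) (by omega),
          floorIn_period_add _ hc (by omega) (by omega),
          floorIn_period_add _ hc (by omega) (by omega), e₁, e₂]
      · rw [hsum, hp]

/-- Partitions with the same floor have equal nim-values (if the totals have the
same parity) or nim-values differing by `⊕ 1` (otherwise); and conversely any
nim-value of a partition is attained at every total of the right parity between
the totals of its floor and its ceiling. -/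
theorem cut_floor_ceiling (c : ℕ) (hc : 2 ≤ c) (p : ℕ) :
    (∀ (n n' : ℕ) (O O' : List ℕ),
      O.length = p → (∀ x ∈ O, 0 < x) → O.sum = n →
      O'.length = p → (∀ x ∈ O', 0 < x) → O'.sum = n' →
      floorPart c O = floorPart c O' →
      ((n % 2 = n' % 2 → nimVal {1, 2*c} O = nimVal {1, 2*c} O') ∧
       (n % 2 ≠ n' % 2 → nimVal {1, 2*c} O = nimVal {1, 2*c} O' ^^^ 1))) ∧
    (∀ (n a b n' : ℕ) (O : List ℕ),
      O.length = p → (∀ x ∈ O, 0 < x) → O.sum = n →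
      (floorPart c O).sum = a → (ceilPart c O).sum = b →
      a ≤ n' → n' ≤ b → n' % 2 = n % 2 →
      ∃ O' : List ℕ, O'.length = p ∧ (∀ x ∈ O', 0 < x) ∧ O'.sum = n' ∧
        nimVal {1, 2*c} O' = nimVal {1, 2*c} O) := by
  refine ⟨?_, ?_⟩
  · intro n n' O O' _ hO hn _ hO' hn' hfloor
    have hv := listVal_eq_floorPart_xor hc O hO
    have hv' := listVal_eq_floorPart_xor hc O' hO'
    rw [nimVal_eq_listVal hc hO, nimVal_eq_listVal hc hO', hv, hv', hfloor, hn, hn',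
      Nat.xor_assoc]
    refine ⟨fun hp => ?_, fun hp => ?_⟩
    · congr 1
      omega
    · congr 1
      rw [show 1 = 1 % 2 from rfl, mod_two_xor_mod_two]
      omega
  · rintro n a b n' O rfl hO rfl rfl rfl ha hb hp
    obtain ⟨O', hlen, hO', hsum, hval⟩ :=
      exists_map_floorIn_eq_floorPart hc O hO n' ha hb hp
    exact ⟨O', hlen, hO', hsum, by
      rw [nimVal_eq_listVal hc hO, nimVal_eq_listVal hc hO', hval]⟩
end
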